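/- arXiv:math/0609708 — 3 statements merged into one kernel-verified Lean document; each statement's English description precedes it below -/
import Mathlib

section
/- Let G = (1 + √5)/2 be the golden ratio, suppose q' is the least element of the set U of univoque numbers, and suppose q'' is the least element of U ∩ (2,3). Then for every real number q > 1: (i) if q ∈ (1, G], then U_q consists exactly of the two endpoints 0 and α₁/(q−1) of J_q; (ii) if q ∈ (G, q') ∪ (2, q''), then U_q is countably infinite; (iii) if q ∈ [q', 2] ∪ [q'', ∞), then U_q has the cardinality of the continuum. -/
open Classical

noncomputable section

/-- The largest digit in base `q`: `α₁ = ⌈q⌉ - 1`. -/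
def alphaOne (q : ℝ) : ℕ := (⌈q⌉ - 1).toNat

/-- `c` (0-indexed: `c i` is the digit `c_{i+1}` of the paper) is an expansion of `x`
in base `q`: all digits lie in `{0, …, α₁}` and `x = ∑_{i≥1} c_i q^{-i}`. -/
def IsExpansionOf (q x : ℝ) (c : ℕ → ℕ) : Prop :=
  (∀ i, c i ≤ alphaOne q) ∧ x = ∑' i, (c i : ℝ) / q ^ (i + 1)

/-- A sequence is called infinite if it has infinitely many nonzero terms. -/
def InfiniteSeq (c : ℕ → ℕ) : Prop := {i | c i ≠ 0}.Infinite

/-- Strict lexicographic order on sequences. -/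
def LexLt (a b : ℕ → ℕ) : Prop := ∃ n, (∀ i, i < n → a i = b i) ∧ a n < b n

/-- Lexicographic order `≤` on sequences. -/
def LexLe (a b : ℕ → ℕ) : Prop := LexLt a b ∨ a = b

/-- `b` is the greedy (lexicographically largest) expansion of `x` in base `q`. -/
def IsGreedyOf (q x : ℝ) (b : ℕ → ℕ) : Prop :=
  IsExpansionOf q x b ∧ ∀ c, IsExpansionOf q x c → LexLe c b

/-- `a` is the quasi-greedy (lexicographically largest infinite) expansion of `x`
in base `q`. -/
def IsQuasiGreedyOf (q x : ℝ) (a : ℕ → ℕ) : Prop :=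
  IsExpansionOf q x a ∧ InfiniteSeq a ∧
    ∀ c, IsExpansionOf q x c → InfiniteSeq c → LexLe c a

/-- The quasi-greedy expansion of `x` in base `q`; by convention it is the zero
sequence whenever no infinite expansion exists (in particular for `x = 0`). -/
def quasiGreedy (q x : ℝ) : ℕ → ℕ :=
  if h : ∃ a, IsQuasiGreedyOf q x a then h.choose else fun _ => 0

/-- The greedy expansion of `x` in base `q` (zero sequence if `x` has no expansion). -/
def greedy (q x : ℝ) : ℕ → ℕ :=
  if h : ∃ b, IsGreedyOf q x b then h.choose else fun _ => 0

/-- The interval `J_q = [0, α₁/(q-1)]`. -/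
def Jq (q : ℝ) : Set ℝ := Set.Icc 0 ((alphaOne q : ℝ) / (q - 1))

/-- `U_q`: the set of real numbers having exactly one expansion in base `q`. -/
def Uq (q : ℝ) : Set ℝ := {x | ∃! c, IsExpansionOf q x c}

/-- `U_q'`: the set of univoque sequences in base `q`. -/
def UqSeq (q : ℝ) : Set (ℕ → ℕ) := {c | ∃ x ∈ Uq q, IsExpansionOf q x c}

/-- `U`: the set of univoque numbers. -/
def USet : Set ℝ := {q | 1 < q ∧ ∃! c, IsExpansionOf q 1 c}

/-- `V_q`: the set of `x ∈ J_q` such that for every `n ≥ 1` with `a_n(x) > 0` the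
conjugated shifted quasi-greedy expansion is lexicographically at most `(α_i)`. -/
def Vq (q : ℝ) : Set ℝ :=
  {x | x ∈ Jq q ∧ ∀ n, 0 < quasiGreedy q x n →
    LexLe (fun i => alphaOne q - quasiGreedy q x (n + 1 + i)) (quasiGreedy q 1)}

/-- `V`: the set of `q > 1` whose quasi-greedy expansion `(α_i)` of `1` satisfies
`(α₁ - α_{k+i})_{i≥1} ≤ (α_i)_{i≥1}` lexicographically for all `k ≥ 1`. -/
def VSet : Set ℝ :=
  {q | 1 < q ∧ ∀ k, LexLe (fun i => alphaOne q - quasiGreedy q 1 (k + 1 + i)) (quasiGreedy q 1)}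


/-- The value `∑ c_i q^{-(i+1)}` of the digit sequence `c` in base `q`. -/
def seqVal (q : ℝ) (c : ℕ → ℕ) : ℝ := ∑' i, (c i : ℝ) / q ^ (i + 1)

/-- The sequence `c` with its first `k` terms removed. -/
def seqShift (k : ℕ) (c : ℕ → ℕ) : ℕ → ℕ := fun i => c (i + k)

/-- The conjugate (digitwise reflection) of `c` with respect to the largest digit `M`. -/
def seqConj (M : ℕ) (c : ℕ → ℕ) : ℕ → ℕ := fun i => M - c i

section Values

variable {q r : ℝ} {M : ℕ} {c d : ℕ → ℕ}

theorem seqShift_zero (c : ℕ → ℕ) : seqShift 0 c = c := rfl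

theorem seqShift_seqShift (j k : ℕ) (c : ℕ → ℕ) :
    seqShift j (seqShift k c) = seqShift (j + k) c := by
  funext i; simp [seqShift, add_assoc]

theorem seqShift_seqConj (k M : ℕ) (c : ℕ → ℕ) :
    seqShift k (seqConj M c) = seqConj M (seqShift k c) := rfl

theorem seqShift_le (hc : ∀ i, c i ≤ M) (k i : ℕ) : seqShift k c i ≤ M := hc _

theorem seqConj_le (i : ℕ) : seqConj M c i ≤ M := Nat.sub_le _ _

theorem seqConj_seqConj (hc : ∀ i, c i ≤ M) : seqConj M (seqConj M c) = c := by
  funext i; simp only [seqConj]; have := hc i; omega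

theorem hasSum_const_div_pow (hq : 1 < q) (M : ℝ) :
    HasSum (fun i : ℕ => M / q ^ (i + 1)) (M / (q - 1)) := by
  have h := (hasSum_geometric_of_lt_one (r := q⁻¹) (by positivity) (inv_lt_one_of_one_lt₀ hq)).mul_left
    (M / q)
  have hq0 : q ≠ 0 := by positivity
  have hq1 : q - 1 ≠ 0 := by linarith
  have e1 : M / q * (1 - q⁻¹)⁻¹ = M / (q - 1) := by field_simp
  have e2 : (fun i : ℕ => M / q * q⁻¹ ^ i) = fun i => M / q ^ (i + 1) := by
    funext i; rw [inv_pow, pow_succ]; field_simp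
  rwa [e1, e2] at h

theorem summable_seqVal (hq : 1 < q) (hc : ∀ i, c i ≤ M) :
    Summable (fun i => (c i : ℝ) / q ^ (i + 1)) := by
  refine Summable.of_nonneg_of_le (fun i => by positivity) (fun i => ?_)
    (hasSum_const_div_pow hq (M : ℝ)).summable
  have : (c i : ℝ) ≤ M := by exact_mod_cast hc i
  gcongr

theorem seqVal_const (hq : 1 < q) : seqVal q (fun _ => M) = M / (q - 1) :=
  (hasSum_const_div_pow hq (M : ℝ)).tsum_eq

theorem seqVal_nonneg (hq : 1 < q) (c : ℕ → ℕ) : 0 ≤ seqVal q c :=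
  tsum_nonneg fun i => by positivity

theorem seqVal_mono (hq : 1 < q) (hd : ∀ i, d i ≤ M) (h : ∀ i, c i ≤ d i) :
    seqVal q c ≤ seqVal q d := by
  refine (summable_seqVal hq fun i => (h i).trans (hd i)).tsum_le_tsum (fun i => ?_)
    (summable_seqVal hq hd)
  have : (c i : ℝ) ≤ d i := by exact_mod_cast h i
  gcongr

theorem seqVal_le (hq : 1 < q) (hc : ∀ i, c i ≤ M) : seqVal q c ≤ M / (q - 1) := by
  rw [← seqVal_const hq]; exact seqVal_mono hq (fun _ => le_rfl) hc

theorem seqVal_conj (hq : 1 < q) (hc : ∀ i, c i ≤ M) :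
    seqVal q (seqConj M c) = M / (q - 1) - seqVal q c := by
  rw [← seqVal_const hq]
  unfold seqVal
  rw [← (summable_seqVal hq (fun _ : ℕ => le_refl M)).tsum_sub (summable_seqVal hq hc)]
  congr 1; funext i
  rw [seqConj, Nat.cast_sub (hc i)]; ring

theorem sum_add_seqVal_shift (hq : 1 < q) (hc : ∀ i, c i ≤ M) (k : ℕ) :
    ∑ i ∈ Finset.range k, (c i : ℝ) / q ^ (i + 1) + seqVal q (seqShift k c) / q ^ k
      = seqVal q c := by
  have h := (summable_seqVal hq hc).sum_add_tsum_nat_add k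
  rw [seqVal, seqVal, ← h, ← tsum_div_const]
  congr 2; funext i
  rw [seqShift, div_div, ← pow_add]; congr 2; ring

theorem seqVal_eq_cons (hq : 1 < q) (hc : ∀ i, c i ≤ M) :
    seqVal q c = (c 0 + seqVal q (seqShift 1 c)) / q := by
  rw [← sum_add_seqVal_shift hq hc 1]; simp; ring

theorem sum_le_seqVal (hq : 1 < q) (hc : ∀ i, c i ≤ M) (k : ℕ) :
    ∑ i ∈ Finset.range k, (c i : ℝ) / q ^ (i + 1) ≤ seqVal q c := by
  rw [← sum_add_seqVal_shift hq hc k]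
  have := seqVal_nonneg hq (seqShift k c)
  have : 0 ≤ seqVal q (seqShift k c) / q ^ k := by positivity
  linarith

theorem seqVal_pos (hq : 1 < q) (hc : ∀ i, c i ≤ M) {i : ℕ} (hi : 0 < c i) : 0 < seqVal q c := by
  have h := (summable_seqVal hq hc).le_tsum i (fun j _ => by positivity)
  refine lt_of_lt_of_le ?_ h
  have : (0 : ℝ) < c i := by exact_mod_cast hi
  positivity

/-- Difference of the values of two sequences with a common prefix of length `k`. -/
theorem seqVal_sub_of_agree (hq : 1 < q) (hc : ∀ i, c i ≤ M) (hd : ∀ i, d i ≤ M) {k : ℕ}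
    (h : ∀ i, i < k → c i = d i) :
    (seqVal q c - seqVal q d) * q ^ (k + 1)
      = c k - d k + seqVal q (seqShift (k + 1) c) - seqVal q (seqShift (k + 1) d) := by
  rw [← sum_add_seqVal_shift hq hc (k + 1), ← sum_add_seqVal_shift hq hd (k + 1),
    Finset.sum_range_succ, Finset.sum_range_succ,
    Finset.sum_congr rfl (fun i hi => by rw [h i (Finset.mem_range.1 hi)])]
  have : q ≠ 0 := by positivity
  field_simp
  ring

theorem seqVal_anti_base (hq : 1 < q) (hqr : q ≤ r) (hc : ∀ i, c i ≤ M) :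
    seqVal r c ≤ seqVal q c := by
  refine (summable_seqVal (hq.trans_le hqr) hc).tsum_le_tsum (fun i => ?_) (summable_seqVal hq hc)
  gcongr

theorem seqVal_strictAnti_base (hq : 1 < q) (hqr : q < r) (hc : ∀ i, c i ≤ M) {i : ℕ}
    (hi : 0 < c i) : seqVal r c < seqVal q c := by
  refine (summable_seqVal (hq.trans hqr) hc).tsum_lt_tsum (i := i) (fun i => ?_) ?_
    (summable_seqVal hq hc)
  · gcongr
  · have : (0 : ℝ) < c i := by exact_mod_cast hi
    gcongr

theorem exists_first_diff (h : c ≠ d) : ∃ k, (∀ i, i < k → c i = d i) ∧ c k ≠ d k := by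
  have hex : ∃ k, c k ≠ d k := Function.ne_iff.1 h
  exact ⟨Nat.find hex, fun i hi => not_not.1 (Nat.find_min hex hi), Nat.find_spec hex⟩

theorem lexLt_trichotomy (c d : ℕ → ℕ) : LexLt c d ∨ c = d ∨ LexLt d c := by
  by_cases h : c = d
  · exact Or.inr (Or.inl h)
  · obtain ⟨k, hk, hne⟩ := exists_first_diff h
    rcases lt_or_gt_of_ne hne with h' | h'
    · exact Or.inl ⟨k, hk, h'⟩
    · exact Or.inr (Or.inr ⟨k, fun i hi => (hk i hi).symm, h'⟩)

/-- If `β` represents `1` in base `r` and every tail of `c` is lexicographically at most `β`,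
then the value of `c` in base `r` is at most `1`. -/
theorem seqVal_le_one_of_lexLe {β : ℕ → ℕ} (hr : 1 < r) (hβM : ∀ i, β i ≤ M)
    (hβ : seqVal r β = 1) (hc : ∀ i, c i ≤ M) (h : ∀ n, LexLe (seqShift n c) β) :
    seqVal r c ≤ 1 := by
  set s : ℝ := ⨆ n, seqVal r (seqShift n c) with hs
  have hbdd : BddAbove (Set.range fun n => seqVal r (seqShift n c)) :=
    ⟨M / (r - 1), by rintro _ ⟨n, rfl⟩; exact seqVal_le hr (seqShift_le hc n)⟩
  have hle : ∀ n, seqVal r (seqShift n c) ≤ s := fun n => le_ciSup hbdd n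
  refine (hle 0).trans ?_
  by_contra! hs1
  have key : ∀ n, seqVal r (seqShift n c) ≤ 1 + (s - 1) / r := by
    intro n
    have hpos : 0 ≤ (s - 1) / r := div_nonneg (by linarith) (by linarith)
    rcases h n with ⟨k, hk, hlt⟩ | heq
    · have h1 := seqVal_sub_of_agree hr (seqShift_le hc n) hβM hk
      rw [seqShift_seqShift, hβ] at h1
      have h2 := hle (k + 1 + n)
      have h3 := seqVal_nonneg hr (seqShift (k + 1) β)
      have h4 : (seqShift n c k : ℝ) + 1 ≤ β k := by exact_mod_cast hlt
      have h5 : (seqVal r (seqShift n c) - 1) * r ^ (k + 1) ≤ s - 1 := by linarith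
      have h6 : r ≤ r ^ (k + 1) := le_self_pow₀ hr.le (by omega)
      rw [← sub_le_iff_le_add', le_div_iff₀ (by linarith)]
      by_cases h7 : seqVal r (seqShift n c) ≤ 1
      · have : (seqVal r (seqShift n c) - 1) * r ≤ 0 :=
          mul_nonpos_of_nonpos_of_nonneg (by linarith) (by linarith)
        linarith
      · have := mul_le_mul_of_nonneg_left h6 (show 0 ≤ seqVal r (seqShift n c) - 1 by linarith)
        linarith
    · rw [heq, hβ]; linarith
  have h1 : s ≤ 1 + (s - 1) / r := ciSup_le key
  have h2 : (s - 1) / r < s - 1 := div_lt_self (by linarith) hr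
  linarith

theorem seqVal_lt_one_of_lexLt {β : ℕ → ℕ} (hr : 1 < r) (hβM : ∀ i, β i ≤ M)
    (hβ : seqVal r β = 1) (hβinf : ∀ k, ∃ i, 0 < β (i + k)) (hc : ∀ i, c i ≤ M)
    (h : ∀ n, LexLe (seqShift n c) β) (hlt : LexLt c β) :
    seqVal r c < 1 := by
  obtain ⟨k, hk, hlt⟩ := hlt
  have h1 := seqVal_sub_of_agree hr hc hβM hk
  have h2 : seqVal r (seqShift (k + 1) c) ≤ 1 :=
    seqVal_le_one_of_lexLe hr hβM hβ (seqShift_le hc _) fun n => by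
      rw [seqShift_seqShift]; exact h _
  obtain ⟨i, hi⟩ := hβinf (k + 1)
  have h3 : 0 < seqVal r (seqShift (k + 1) β) := seqVal_pos hr (seqShift_le hβM _) (i := i) hi
  have h4 : (c k : ℝ) + 1 ≤ β k := by exact_mod_cast hlt
  rw [hβ] at h1
  have h5 : (seqVal r c - 1) * r ^ (k + 1) < 0 := by linarith
  have := neg_of_mul_neg_left h5 (by positivity)
  linarith

/-- Every point of `[0, M/(q-1)]` has an expansion with digits at most `M` when `q ≤ M + 1`. -/
theorem exists_seqVal_eq (hq : 1 < q) (hqM : q ≤ M + 1) {x : ℝ} (hx0 : 0 ≤ x)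
    (hx : x ≤ M / (q - 1)) : ∃ c : ℕ → ℕ, (∀ i, c i ≤ M) ∧ seqVal q c = x := by
  have hq1 : 0 < q - 1 := by linarith
  let dig : ℝ → ℕ := fun y => min M ⌊q * y⌋₊
  let y : ℕ → ℝ := fun n => (fun z => q * z - dig z)^[n] x
  have hysucc : ∀ n, y (n + 1) = q * y n - dig (y n) := fun n => by
    simp only [y, Function.iterate_succ_apply']
  have hy : ∀ n, 0 ≤ y n ∧ y n ≤ M / (q - 1) := by
    intro n
    induction n with
    | zero => exact ⟨hx0, hx⟩
    | succ n ih =>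
      obtain ⟨h0, h1⟩ := ih
      have hqy : 0 ≤ q * y n := by positivity
      rw [hysucc]
      rw [le_div_iff₀ hq1] at h1 ⊢
      rcases le_total M ⌊q * y n⌋₊ with h | h
      · have hd : dig (y n) = M := min_eq_left h
        rw [hd]
        have h2 : (M : ℝ) ≤ q * y n := (Nat.le_floor_iff hqy).1 h
        exact ⟨by linarith, by nlinarith⟩
      · have hd : dig (y n) = ⌊q * y n⌋₊ := min_eq_right h
        rw [hd]
        have h2 := Nat.floor_le hqy
        have h3 := Nat.lt_floor_add_one (q * y n)
        exact ⟨by linarith, by nlinarith⟩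
  refine ⟨fun n => dig (y n), fun n => min_le_left _ _, ?_⟩
  have hsum : ∀ n, ∑ i ∈ Finset.range n, (dig (y i) : ℝ) / q ^ (i + 1) = x - y n / q ^ n := by
    intro n
    induction n with
    | zero => simp [y]
    | succ n ih =>
      rw [Finset.sum_range_succ, ih, hysucc]
      have : q ≠ 0 := by positivity
      field_simp
      ring
  have hlim : Filter.Tendsto (fun n => y n / q ^ n) Filter.atTop (nhds 0) := by
    have hg : Filter.Tendsto (fun n : ℕ => (M / (q - 1)) * (q⁻¹) ^ n) Filter.atTop (nhds 0) := by
      have := tendsto_pow_atTop_nhds_zero_of_lt_one (r := q⁻¹) (by positivity)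
        (inv_lt_one_of_one_lt₀ hq)
      simpa using this.const_mul ((M : ℝ) / (q - 1))
    refine squeeze_zero (fun n => div_nonneg (hy n).1 (by positivity)) (fun n => ?_) hg
    rw [inv_pow, ← div_eq_mul_inv]
    have := (hy n).2
    gcongr
  have hs : Summable fun i => (dig (y i) : ℝ) / q ^ (i + 1) :=
    summable_seqVal (M := M) (c := fun n => dig (y n)) hq fun n => min_le_left _ _
  have h1 := hs.hasSum.tendsto_sum_nat
  simp only [hsum] at h1
  have h2 := (tendsto_const_nhds (x := x)).sub hlim
  rw [sub_zero] at h2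
  exact tendsto_nhds_unique h1 h2

end Values

section Univoque

variable {q r : ℝ} {M : ℕ} {c d : ℕ → ℕ}

/-- After every digit that is not maximal, the remaining tail has value less than `1`. -/
def IsGreedySeq (q : ℝ) (M : ℕ) (c : ℕ → ℕ) : Prop :=
  ∀ n, c n < M → seqVal q (seqShift (n + 1) c) < 1

/-- The digit sequences over `{0, …, M}` that are unique expansions in base `q`. -/
structure IsUnivoqueSeq (q : ℝ) (M : ℕ) (c : ℕ → ℕ) : Prop where
  le : ∀ i, c i ≤ M
  greedy : IsGreedySeq q M c
  lazy : IsGreedySeq q M (seqConj M c)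

theorem IsUnivoqueSeq.conj (h : IsUnivoqueSeq q M c) : IsUnivoqueSeq q M (seqConj M c) :=
  ⟨seqConj_le, h.lazy, by rw [seqConj_seqConj h.le]; exact h.greedy⟩

theorem IsUnivoqueSeq.of_forall_lt (hc : ∀ i, c i ≤ M)
    (h1 : ∀ n, seqVal q (seqShift (n + 1) c) < 1)
    (h2 : ∀ n, seqVal q (seqShift (n + 1) (seqConj M c)) < 1) : IsUnivoqueSeq q M c :=
  ⟨hc, fun n _ => h1 n, fun n _ => h2 n⟩

theorem IsUnivoqueSeq.eq_of_seqVal_eq (hq : 1 < q) (h : IsUnivoqueSeq q M c)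
    (hd : ∀ i, d i ≤ M) (hcd : seqVal q d = seqVal q c) : d = c := by
  by_contra hne
  obtain ⟨k, hk, hk'⟩ := exists_first_diff hne
  have h1 := seqVal_sub_of_agree hq hd h.le hk
  rw [hcd, sub_self, zero_mul] at h1
  rcases lt_or_gt_of_ne hk' with hlt | hlt
  · have h2 := h.lazy k (by have := h.le k; simp only [seqConj]; omega)
    rw [seqShift_seqConj, seqVal_conj hq (seqShift_le h.le _)] at h2
    have h3 := seqVal_le hq (seqShift_le hd (k + 1))
    have h4 : (d k : ℝ) + 1 ≤ c k := by exact_mod_cast hlt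
    linarith
  · have h2 := h.greedy k (by have := hd k; omega)
    have h3 := seqVal_nonneg hq (seqShift (k + 1) d)
    have h4 : (c k : ℝ) + 1 ≤ d k := by exact_mod_cast hlt
    linarith

theorem isGreedySeq_of_unique (hq : 1 < q) (hqM : q ≤ M + 1) (hc : ∀ i, c i ≤ M)
    (h : ∀ d : ℕ → ℕ, (∀ i, d i ≤ M) → seqVal q d = seqVal q c → d = c) :
    IsGreedySeq q M c := by
  intro n hn
  by_contra! hle
  obtain ⟨e, he, hev⟩ := exists_seqVal_eq hq hqM
    (x := seqVal q (seqShift (n + 1) c) - 1) (by linarith)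
    (by have := seqVal_le hq (seqShift_le hc (n + 1)); linarith)
  let d : ℕ → ℕ := fun i => if i < n then c i else if i = n then c n + 1 else e (i - (n + 1))
  have hd : ∀ i, d i ≤ M := by
    intro i
    simp only [d]
    split_ifs
    · exact hc i
    · exact hn
    · exact he _
  have hshift : seqShift (n + 1) d = e := by
    funext i
    have h1 : ¬ i + (n + 1) < n := by omega
    have h2 : ¬ i + (n + 1) = n := by omega
    simp [seqShift, d, h1, h2]
  have hdn : d n = c n + 1 := by simp [d]
  have h1 := seqVal_sub_of_agree hq hd hc (k := n) (fun i hi => by simp [d, hi])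
  rw [hshift, hev, hdn] at h1
  push_cast at h1
  have h2 : (seqVal q d - seqVal q c) * q ^ (n + 1) = 0 := by rw [h1]; ring
  have h3 : q ^ (n + 1) ≠ 0 := by positivity
  have h4 := h d hd (sub_eq_zero.1 ((mul_eq_zero.1 h2).resolve_right h3))
  have h5 := congrFun h4 n
  omega

theorem isUnivoqueSeq_of_unique (hq : 1 < q) (hqM : q ≤ M + 1) (hc : ∀ i, c i ≤ M)
    (h : ∀ d : ℕ → ℕ, (∀ i, d i ≤ M) → seqVal q d = seqVal q c → d = c) :
    IsUnivoqueSeq q M c := by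
  refine ⟨hc, isGreedySeq_of_unique hq hqM hc h,
    isGreedySeq_of_unique hq hqM seqConj_le fun d hd hdv => ?_⟩
  rw [← h (seqConj M d) seqConj_le ?_, seqConj_seqConj hd]
  rw [seqVal_conj hq hd, hdv, seqVal_conj hq hc]
  ring

theorem alphaOne_eq (h1 : (M : ℝ) < q) (h2 : q ≤ M + 1) : alphaOne q = M := by
  have h : ⌈q⌉ = (M : ℤ) + 1 := by
    rw [Int.ceil_eq_iff]; push_cast; exact ⟨by linarith, h2⟩
  simp [alphaOne, h]

theorem alphaOne_lt (hq : 1 < q) : (alphaOne q : ℝ) < q := by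
  have h : (1 : ℤ) < ⌈q⌉ := by rw [Int.lt_ceil]; exact_mod_cast hq
  have h1 : ((alphaOne q : ℤ) : ℝ) = ((⌈q⌉ - 1 : ℤ) : ℝ) := by
    rw [alphaOne, Int.toNat_of_nonneg (by omega)]
  have h2 := Int.ceil_lt_add_one q
  push_cast at h1
  linarith

theorem le_alphaOne_add_one (q : ℝ) : q ≤ alphaOne q + 1 := by
  have h1 : ((⌈q⌉ - 1 : ℤ) : ℝ) ≤ ((alphaOne q : ℤ) : ℝ) := by
    rw [alphaOne]; exact_mod_cast Int.self_le_toNat _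
  have h2 := Int.le_ceil q
  push_cast at h1
  linarith

theorem mem_Uq_iff (hq : 1 < q) {x : ℝ} :
    x ∈ Uq q ↔ ∃ c, IsUnivoqueSeq q (alphaOne q) c ∧ seqVal q c = x := by
  constructor
  · rintro ⟨c, ⟨hc, hx⟩, hu⟩
    exact ⟨c, isUnivoqueSeq_of_unique hq (le_alphaOne_add_one q) hc
      fun d hd hdv => hu d ⟨hd, hx.trans hdv.symm⟩, hx.symm⟩
  · rintro ⟨c, hc, rfl⟩
    exact ⟨c, ⟨hc.le, rfl⟩, fun d hd => hc.eq_of_seqVal_eq hq hd.1 hd.2.symm⟩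

theorem seqVal_shift_one_of_eq (hq : 1 < q) (hc : ∀ i, c i ≤ M) (h0 : c 0 = M) :
    seqVal q (seqShift 1 c) = q * seqVal q c - M := by
  have hq0 : q ≠ 0 := by positivity
  rw [seqVal_eq_cons hq hc, h0]; field_simp; ring

theorem IsGreedySeq.shift_lt_one (hq : 1 < q) (hqM : q ≤ M + 1) (hc : ∀ i, c i ≤ M)
    (h : IsGreedySeq q M c) {n : ℕ} (hn : c n < M) {k : ℕ} (hk : n < k) :
    seqVal q (seqShift k c) < 1 := by
  induction k, hk using Nat.le_induction with
  | base => exact h n hn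
  | succ k _ ih =>
    rcases (hc k).lt_or_eq with hlt | heq
    · exact h k hlt
    · have h1 := seqVal_shift_one_of_eq hq (seqShift_le hc k) (by simpa [seqShift] using heq)
      rw [seqShift_seqShift, add_comm] at h1
      nlinarith

theorem IsGreedySeq.shift_le_one (hq : 1 < q) (hqM : q ≤ M + 1) (hc : ∀ i, c i ≤ M)
    (h : IsGreedySeq q M c) (h1 : seqVal q c ≤ 1) (k : ℕ) : seqVal q (seqShift k c) ≤ 1 := by
  induction k with
  | zero => exact h1
  | succ k ih =>
    rcases (hc k).lt_or_eq with hlt | heq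
    · exact (h k hlt).le
    · have h1 := seqVal_shift_one_of_eq hq (seqShift_le hc k) (by simpa [seqShift] using heq)
      rw [seqShift_seqShift, add_comm] at h1
      nlinarith

end Univoque

section KomornikLoreti

variable {M : ℕ}

/-- The blocks `u_n` of length `2 ^ n`: `u_0 = M`, and `u_{n+1}` is `u_n` followed by its
conjugate with the last digit increased by one. -/
def klBlock (M : ℕ) : ℕ → ℕ → ℕ
  | 0, _ => M
  | n + 1, i =>
    if i < 2 ^ n then klBlock M n i
    else if i + 1 = 2 ^ (n + 1) then M - klBlock M n (2 ^ n - 1) + 1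
    else M - klBlock M n (i - 2 ^ n)

/-- The (generalized) Komornik–Loreti sequence, the common extension of the blocks. -/
def klSeq (M i : ℕ) : ℕ := klBlock M i i

theorem klBlock_eq_of_le {n m i : ℕ} (hnm : n ≤ m) (hi : i < 2 ^ n) :
    klBlock M m i = klBlock M n i := by
  induction m, hnm using Nat.le_induction with
  | base => rfl
  | succ m hm ih =>
    have : i < 2 ^ m := hi.trans_le (Nat.pow_le_pow_right (by omega) hm)
    rw [klBlock, if_pos this, ih]

theorem klSeq_eq_klBlock {n i : ℕ} (hi : i < 2 ^ n) : klSeq M i = klBlock M n i := by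
  rcases le_total n i with h | h
  · exact klBlock_eq_of_le h hi
  · exact (klBlock_eq_of_le h Nat.lt_two_pow_self).symm

theorem klSeq_zero : klSeq M 0 = M := rfl

theorem klSeq_add {n i : ℕ} (hi : i + 1 < 2 ^ n) : klSeq M (2 ^ n + i) = M - klSeq M i := by
  rw [klSeq_eq_klBlock (n := n + 1) (by rw [pow_succ]; omega), klBlock, if_neg (by omega),
    if_neg (by rw [pow_succ]; omega), Nat.add_sub_cancel_left, klSeq_eq_klBlock (n := n) (by omega)]

theorem klSeq_add_last {n i : ℕ} (hi : i + 1 = 2 ^ n) :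
    klSeq M (2 ^ n + i) = M - klSeq M i + 1 := by
  rw [klSeq_eq_klBlock (n := n + 1) (by rw [pow_succ]; omega), klBlock, if_neg (by omega),
    if_pos (by rw [pow_succ]; omega), klSeq_eq_klBlock (n := n) (by omega)]
  congr 3; omega

theorem klSeq_last (hM : 0 < M) {n i : ℕ} (hi : i + 1 = 2 ^ n) :
    1 ≤ klSeq M i ∧ klSeq M i ≤ M := by
  induction n generalizing i with
  | zero =>
    obtain rfl : i = 0 := by simpa using hi
    rw [klSeq_zero]; omega
  | succ n ih =>
    have hN := Nat.one_le_two_pow (n := n)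
    have h := ih (i := 2 ^ n - 1) (by omega)
    obtain rfl : i = 2 ^ n + (2 ^ n - 1) := by rw [pow_succ] at hi; omega
    rw [klSeq_add_last (by omega)]
    omega

theorem klSeq_le (hM : 0 < M) (i : ℕ) : klSeq M i ≤ M := by
  suffices h : ∀ n i, i < 2 ^ n → klSeq M i ≤ M from h i i Nat.lt_two_pow_self
  intro n
  induction n with
  | zero => intro i hi; obtain rfl : i = 0 := by simpa using hi
            exact klSeq_zero.le
  | succ n ih =>
    intro i hi
    rcases lt_or_ge i (2 ^ n) with h | h
    · exact ih i h
    · obtain ⟨j, rfl⟩ := Nat.exists_eq_add_of_le h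
      rw [pow_succ] at hi
      rcases (show j + 1 ≤ 2 ^ n by omega).lt_or_eq with h' | h'
      · rw [klSeq_add h']; omega
      · exact (klSeq_last hM (n := n + 1) (by rw [pow_succ]; omega)).2

/-- `a` is smaller than `b` already on the first `L` digits. -/
def PrefixLt (L : ℕ) (a b : ℕ → ℕ) : Prop := ∃ k < L, (∀ i < k, a i = b i) ∧ a k < b k

theorem PrefixLt.mono {L L' : ℕ} (h : L ≤ L') {a b : ℕ → ℕ} : PrefixLt L a b → PrefixLt L' a b :=
  fun ⟨k, hk, hab⟩ => ⟨k, hk.trans_le h, hab⟩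

theorem PrefixLt.lexLt {L : ℕ} {a b : ℕ → ℕ} : PrefixLt L a b → LexLt a b :=
  fun ⟨k, _, hab⟩ => ⟨k, hab⟩

theorem klSeq_block_step (hM : 0 < M) {n j : ℕ} (hjn : j < 2 ^ n)
    (h1 : PrefixLt (2 ^ n - j) (seqShift j (klSeq M)) (klSeq M) ∨
      ∀ i < 2 ^ n - j, seqShift j (klSeq M) i = klSeq M i)
    (h2 : PrefixLt j (seqShift (2 ^ n - j) (seqConj M (klSeq M))) (klSeq M)) :
    PrefixLt (2 ^ (n + 1) - j) (seqShift j (klSeq M)) (klSeq M) := by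
  rcases h1 with h1 | h1
  · exact h1.mono (by rw [pow_succ]; omega)
  · obtain ⟨k, hk, hka, hkl⟩ := h2
    have hle := klSeq_le hM
    have hval : ∀ i, i < j → seqShift j (klSeq M) (2 ^ n - j + i) = M - klSeq M i := by
      intro i hi
      rw [seqShift, ← klSeq_add (n := n) (i := i) (by omega)]
      congr 1; omega
    refine ⟨2 ^ n - j + k, by rw [pow_succ]; omega, fun i hi => ?_, ?_⟩
    · rcases lt_or_ge i (2 ^ n - j) with h | h
      · exact h1 i h
      · obtain ⟨l, rfl⟩ := Nat.exists_eq_add_of_le h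
        rw [hval l (by omega), ← hka l (by omega)]
        have := hle (2 ^ n - j + l)
        simp only [seqShift, seqConj]
        rw [add_comm l]
        omega
    · rw [hval k hk]
      simp only [seqShift, seqConj] at hkl
      rw [add_comm k] at hkl
      have := hle (2 ^ n - j + k)
      have := hle k
      omega

theorem klSeq_block (hM : 0 < M) (n : ℕ) : ∀ j, 0 < j → j < 2 ^ n →
    (PrefixLt (2 ^ n - j) (seqShift j (klSeq M)) (klSeq M) ∨
      ∀ i < 2 ^ n - j, seqShift j (klSeq M) i = klSeq M i) ∧
    PrefixLt (2 ^ n - j) (seqShift j (seqConj M (klSeq M))) (klSeq M) := by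
  induction n with
  | zero => intro j h1 h2; simp at h2; omega
  | succ n ih =>
    intro j hj hjn
    have hle := klSeq_le hM
    have hpow : 2 ^ (n + 1) = 2 ^ n + 2 ^ n := by rw [pow_succ]; omega
    rcases lt_or_ge j (2 ^ n) with h | h
    · have h2 := (ih (2 ^ n - j) (by omega) (by omega)).2
      rw [Nat.sub_sub_self h.le] at h2
      exact ⟨Or.inl (klSeq_block_step hM h (ih j hj h).1 h2),
        (ih j hj h).2.mono (by omega)⟩
    · obtain ⟨i, rfl⟩ := Nat.exists_eq_add_of_le h
      have hlen : 2 ^ (n + 1) - (2 ^ n + i) = 2 ^ n - i := by omega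
      rw [hlen]
      have hval : ∀ l, i + l + 1 < 2 ^ n →
          seqShift (2 ^ n + i) (klSeq M) l = M - klSeq M (l + i) := by
        intro l hl
        rw [seqShift, ← klSeq_add (n := n) (by omega)]
        congr 1; omega
      have hlast : ∀ l, i + l + 1 = 2 ^ n →
          seqShift (2 ^ n + i) (klSeq M) l = M - klSeq M (l + i) + 1 := by
        intro l hl
        rw [seqShift, ← klSeq_add_last (n := n) (by omega)]
        congr 1; omega
      have hone : ∀ l, i + l + 1 = 2 ^ n → 1 ≤ klSeq M (l + i) := fun l hl =>
        (klSeq_last hM (n := n) (by omega)).1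
      rcases Nat.eq_zero_or_pos i with rfl | hi
      · constructor
        · rcases Nat.eq_zero_or_pos n with rfl | hn
          · have h0 := hlast 0 (by simp)
            simp only [add_zero, klSeq_zero, Nat.sub_self, zero_add] at h0
            rcases Nat.lt_or_ge 1 M with h1 | h1
            · refine Or.inl ⟨0, by simp, by simp, ?_⟩
              rw [add_zero, h0]; exact h1
            · refine Or.inr fun l hl => ?_
              obtain rfl : l = 0 := by simpa using hl
              rw [add_zero, h0, klSeq_zero]; omega
          · have : 2 ≤ 2 ^ n := Nat.le_self_pow (by omega) 2
            refine Or.inl ⟨0, by omega, by simp, ?_⟩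
            rw [hval 0 (by omega)]
            simp only [add_zero, klSeq_zero]; omega
        · refine ⟨2 ^ n - 1, by omega, fun l hl => ?_, ?_⟩
          · rw [seqShift_seqConj, seqConj, hval l (by omega)]
            have := hle l
            simp only [add_zero]; omega
          · rw [seqShift_seqConj, seqConj, hlast _ (by omega)]
            have h1 := hone (2 ^ n - 1) (by omega)
            have := hle (2 ^ n - 1)
            simp only [add_zero] at h1 ⊢; omega
      · obtain ⟨h1, k, hk, hka, hkl⟩ := ih i hi (by omega)
        constructor
        · rw [seqShift_seqConj] at hka hkl
          simp only [seqConj, seqShift] at hka hkl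
          rcases (show i + k + 1 ≤ 2 ^ n by omega).lt_or_eq with h' | h'
          · refine Or.inl ⟨k, hk, fun l hl => ?_, ?_⟩
            · rw [hval l (by omega)]; exact hka l hl
            · rw [hval k h']; exact hkl
          · rcases (show M - klSeq M (k + i) + 1 ≤ klSeq M k by omega).lt_or_eq with h3 | h3
            · refine Or.inl ⟨k, hk, fun l hl => ?_, ?_⟩
              · rw [hval l (by omega)]; exact hka l hl
              · rw [hlast k h']; exact h3
            · refine Or.inr fun l hl => ?_
              rcases (show l ≤ k by omega).lt_or_eq with h4 | rfl
              · rw [hval l (by omega)]; exact hka l h4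
              · rw [hlast l h']; exact h3
        · rcases h1 with ⟨k, hk, hka, hkl⟩ | h1
          · simp only [seqShift] at hka hkl
            have hconj : ∀ l ≤ k, seqShift (2 ^ n + i) (seqConj M (klSeq M)) l ≤ klSeq M (l + i) ∧
                (l < k → seqShift (2 ^ n + i) (seqConj M (klSeq M)) l = klSeq M (l + i)) := by
              intro l hl
              rw [seqShift_seqConj, seqConj]
              have := hle (l + i)
              rcases (show i + l + 1 ≤ 2 ^ n by omega).lt_or_eq with h' | h'
              · rw [hval l h']; omega
              · rw [hlast l h']; have := hone l h'; omega
            exact ⟨k, hk, fun l hl => by rw [(hconj l hl.le).2 hl, hka l hl],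
              (hconj k le_rfl).1.trans_lt hkl⟩
          · refine ⟨2 ^ n - i - 1, by omega, fun l hl => ?_, ?_⟩
            · rw [seqShift_seqConj, seqConj, hval l (by omega), ← h1 l (by omega), seqShift]
              have := hle (l + i)
              omega
            · rw [seqShift_seqConj, seqConj, hlast (2 ^ n - i - 1) (by omega),
                ← h1 (2 ^ n - i - 1) (by omega), seqShift]
              have := hle (2 ^ n - i - 1 + i)
              have := hone (2 ^ n - i - 1) (by omega)
              omega

theorem klSeq_shift_lexLt (hM : 0 < M) {k : ℕ} (hk : 0 < k) :
    LexLt (seqShift k (klSeq M)) (klSeq M) := by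
  have hlt : k < 2 ^ k := Nat.lt_two_pow_self
  have h2 := (klSeq_block hM k (2 ^ k - k) (by omega) (by omega)).2
  rw [Nat.sub_sub_self hlt.le] at h2
  exact (klSeq_block_step hM hlt (klSeq_block hM k k hk hlt).1 h2).lexLt

theorem klSeq_shift_conj_lexLt (hM : 0 < M) (k : ℕ) :
    LexLt (seqShift k (seqConj M (klSeq M))) (klSeq M) := by
  rcases Nat.eq_zero_or_pos k with rfl | hk
  · exact ⟨0, by simp, by simp [seqShift, seqConj, klSeq_zero, hM]⟩
  · exact (klSeq_block hM k k hk Nat.lt_two_pow_self).2.lexLt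

theorem LexLt.ne {a b : ℕ → ℕ} (h : LexLt a b) : a ≠ b := by
  rintro rfl
  obtain ⟨k, _, hk⟩ := h
  exact lt_irrefl _ hk

theorem klSeq_recurrent (hM : 0 < M) {n i : ℕ} (hi : i + 1 < 2 ^ n) :
    klSeq M (i + 3 * 2 ^ n) = klSeq M i := by
  have h : i + 3 * 2 ^ n = 2 ^ (n + 1) + (2 ^ n + i) := by rw [pow_succ]; omega
  rw [h, klSeq_add (by rw [pow_succ]; omega), klSeq_add hi, Nat.sub_sub_self (klSeq_le hM i)]

theorem klSeq_shift_ne (hM : 0 < M) {k m : ℕ} (hm : 0 < m) :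
    seqShift k (klSeq M) ≠ seqShift (m + k) (klSeq M) := by
  intro h
  have hper : ∀ i, k ≤ i → klSeq M i = klSeq M (i + m) := by
    intro i hi
    have := congrFun h (i - k)
    simp only [seqShift] at this
    rw [show i - k + k = i by omega, show i - k + (m + k) = i + m by omega] at this
    exact this
  refine (klSeq_shift_lexLt hM hm).ne (funext fun i => ?_)
  have hlt : i + m + k + 1 < 2 ^ (i + m + k + 1) := Nat.lt_two_pow_self
  have h1 := klSeq_recurrent hM (n := i + m + k + 1) (i := i) (by omega)
  have h2 := klSeq_recurrent hM (n := i + m + k + 1) (i := i + m) (by omega)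
  rw [seqShift, ← h1, ← h2, hper (i + 3 * 2 ^ (i + m + k + 1)) (by omega)]
  congr 1; omega

end KomornikLoreti

section Descent

variable {M : ℕ} {c : ℕ → ℕ}

/-- No tail of `c` or of its conjugate reaches the block `u_n`. -/
structure IsBlockBounded (M n : ℕ) (c : ℕ → ℕ) : Prop where
  le : ∀ i, c i ≤ M
  lt : ∀ j, PrefixLt (2 ^ n) (seqShift j c) (klSeq M)
  conj_lt : ∀ j, PrefixLt (2 ^ n) (seqShift j (seqConj M c)) (klSeq M)

theorem IsBlockBounded.conj {n : ℕ} (h : IsBlockBounded M n c) :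
    IsBlockBounded M n (seqConj M c) :=
  ⟨seqConj_le, h.conj_lt, by rw [seqConj_seqConj h.le]; exact h.lt⟩

theorem IsBlockBounded.shift {n : ℕ} (h : IsBlockBounded M n c) (k : ℕ) :
    IsBlockBounded M n (seqShift k c) :=
  ⟨seqShift_le h.le k, fun j => by rw [seqShift_seqShift]; exact h.lt _, fun j => by
    rw [← seqShift_seqConj, seqShift_seqShift]; exact h.conj_lt _⟩

theorem IsBlockBounded.conj_shift_of_prefix {n : ℕ} (hM : 0 < M)
    (h : IsBlockBounded M (n + 1) c) (hpre : ∀ i < 2 ^ n, c i = klSeq M i) :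
    ∀ i < 2 ^ n, seqConj M (seqShift (2 ^ n) c) i = klSeq M i := by
  have hpow : 2 ^ (n + 1) = 2 ^ n + 2 ^ n := by rw [pow_succ]; omega
  obtain ⟨k, hk, hka, hkl⟩ := h.lt 0
  rw [seqShift_zero] at hka hkl
  obtain ⟨k', hk', hka', hkl'⟩ := h.conj_lt (2 ^ n)
  rw [seqShift_seqConj] at hka' hkl'
  have hk2 : 2 ^ n ≤ k := by
    by_contra! hlt
    exact hkl.ne (hpre k hlt)
  obtain ⟨l, rfl⟩ := Nat.exists_eq_add_of_le hk2
  rcases lt_or_ge k' (2 ^ n) with hlt | hge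
  · exfalso
    have hle := klSeq_le hM
    simp only [seqConj, seqShift] at hka' hkl'
    have hval : ∀ i, i + 1 < 2 ^ n → klSeq M (2 ^ n + i) = M - klSeq M i := fun i => klSeq_add
    have hcl := h.le (l + 2 ^ n)
    have hkle := hle k'
    rw [add_comm (2 ^ n) l] at hkl
    rcases lt_trichotomy l k' with h1 | rfl | h1
    · have h2 := hka' l h1
      have h3 := hval l (by omega)
      rw [add_comm] at h3
      omega
    · rcases (show l + 1 ≤ 2 ^ n by omega).lt_or_eq with h2 | h2
      · have h3 := hval l h2
        rw [add_comm] at h3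
        omega
      · have h3 := klSeq_add_last (M := M) h2
        rw [add_comm] at h3
        omega
    · have h2 := hka (2 ^ n + k') (by omega)
      have h3 := hval k' (by omega)
      rw [add_comm] at h2 h3
      omega
  · exact fun i hi => hka' i (by omega)

theorem IsBlockBounded.add_eq_conj_of_prefix {n : ℕ} (hM : 0 < M)
    (h : IsBlockBounded M (n + 1) c) (hpre : ∀ i < 2 ^ n, c i = klSeq M i) (i : ℕ) :
    c (i + 2 ^ n) = M - c i := by
  suffices H : ∀ l r, r < 2 ^ n → ∀ c, IsBlockBounded M (n + 1) c →
      (∀ i < 2 ^ n, c i = klSeq M i) → c (r + l * 2 ^ n + 2 ^ n) = M - c (r + l * 2 ^ n) by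
    have := H (i / 2 ^ n) (i % 2 ^ n) (Nat.mod_lt _ (by positivity)) c h hpre
    rwa [mul_comm, Nat.mod_add_div] at this
  intro l r hr
  induction l with
  | zero =>
    intro c h hpre
    have h1 := h.conj_shift_of_prefix hM hpre r hr
    rw [← hpre r hr] at h1
    simp only [seqConj, seqShift] at h1
    have := h.le (r + 2 ^ n)
    simp only [zero_mul, add_zero]
    omega
  | succ l ih =>
    intro c h hpre
    have h1 := ih _ (h.shift (2 ^ n)).conj (h.conj_shift_of_prefix hM hpre)
    simp only [seqConj, seqShift] at h1
    have e1 : r + (l + 1) * 2 ^ n = r + l * 2 ^ n + 2 ^ n := by ring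
    rw [e1]
    have := h.le (r + l * 2 ^ n + 2 ^ n + 2 ^ n)
    have := h.le (r + l * 2 ^ n + 2 ^ n)
    omega

theorem IsBlockBounded.periodic_of_prefix {n : ℕ} (hM : 0 < M)
    (h : IsBlockBounded M (n + 1) c) (hpre : ∀ i < 2 ^ n, c i = klSeq M i) (i : ℕ) :
    c (i + 2 ^ (n + 1)) = c i := by
  have h1 := h.add_eq_conj_of_prefix hM hpre i
  have h2 := h.add_eq_conj_of_prefix hM hpre (i + 2 ^ n)
  rw [show i + 2 ^ (n + 1) = i + 2 ^ n + 2 ^ n by rw [pow_succ]; ring, h2, h1,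
    Nat.sub_sub_self (h.le i)]

theorem prefixLt_or_agree_of_prefixLt {L L' : ℕ} {a b : ℕ → ℕ} (h : PrefixLt L' a b) :
    PrefixLt L a b ∨ ∀ i < L, a i = b i := by
  obtain ⟨k, _, hka, hkl⟩ := h
  rcases lt_or_ge k L with h | h
  · exact Or.inl ⟨k, h, hka, hkl⟩
  · exact Or.inr fun i hi => hka i (by omega)

theorem IsBlockBounded.descend {n : ℕ} (hM : 0 < M) (h : IsBlockBounded M (n + 1) c) :
    IsBlockBounded M n c ∨ ∃ j, ∀ i < 2 ^ n, seqShift j c i = klSeq M i := by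
  by_cases h1 : ∃ j, ∀ i < 2 ^ n, seqShift j c i = klSeq M i
  · exact Or.inr h1
  by_cases h2 : ∃ j, ∀ i < 2 ^ n, seqShift j (seqConj M c) i = klSeq M i
  · obtain ⟨j, hj⟩ := h2
    refine Or.inr ⟨2 ^ n + j, ?_⟩
    have h3 := (h.conj.shift j).conj_shift_of_prefix hM hj
    rw [seqShift_seqShift, seqShift_seqConj, seqConj_seqConj (seqShift_le h.le _)] at h3
    exact h3
  push Not at h1 h2
  exact Or.inl ⟨h.le,
    fun j => (prefixLt_or_agree_of_prefixLt (h.lt j)).resolve_right (by push Not; exact h1 j),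
    fun j => (prefixLt_or_agree_of_prefixLt (h.conj_lt j)).resolve_right (by push Not; exact h2 j)⟩

theorem IsBlockBounded.exists_prefix {n : ℕ} (hM : 0 < M) (h : IsBlockBounded M n c) :
    IsBlockBounded M 0 c ∨ ∃ m j, IsBlockBounded M (m + 1) c ∧
      ∀ i < 2 ^ m, seqShift j c i = klSeq M i := by
  induction n with
  | zero => exact Or.inl h
  | succ n ih =>
    rcases h.descend hM with h1 | ⟨j, hj⟩
    · exact ih h1
    · exact Or.inr ⟨n, j, h, hj⟩

theorem IsBlockBounded.zero_lt (h : IsBlockBounded M 0 c) (i : ℕ) : 0 < c i ∧ c i < M := by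
  obtain ⟨k, hk, -, hkl⟩ := h.lt i
  obtain ⟨k', hk', -, hkl'⟩ := h.conj_lt i
  obtain rfl : k = 0 := by simpa using hk
  obtain rfl : k' = 0 := by simpa using hk'
  simp only [seqShift, seqConj, klSeq_zero, zero_add] at hkl hkl'
  omega

/-- A sequence that is periodic from some index on. -/
def IsEventuallyPeriodic (c : ℕ → ℕ) : Prop := ∃ j P, 0 < P ∧ ∀ i, j ≤ i → c (i + P) = c i

theorem IsEventuallyPeriodic.of_shift {k : ℕ} (h : IsEventuallyPeriodic (seqShift k c)) :
    IsEventuallyPeriodic c := by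
  obtain ⟨j, P, hP, h⟩ := h
  refine ⟨j + k, P, hP, fun i hi => ?_⟩
  have := h (i - k) (by omega)
  simp only [seqShift] at this
  rwa [show i - k + P + k = i + P by omega, show i - k + k = i by omega] at this

theorem IsBlockBounded.isEventuallyPeriodic {n : ℕ} (hM : 0 < M) (hM2 : M ≤ 2)
    (h : IsBlockBounded M n c) : IsEventuallyPeriodic c := by
  rcases h.exists_prefix hM with h0 | ⟨m, j, hm, hj⟩
  · refine ⟨0, 1, one_pos, fun i _ => ?_⟩
    have h1 := h0.zero_lt i
    have h2 := h0.zero_lt (i + 1)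
    omega
  · exact IsEventuallyPeriodic.of_shift (k := j)
      ⟨0, 2 ^ (m + 1), by positivity, fun i _ => (hm.shift j).periodic_of_prefix hM hj i⟩

theorem countable_setOf_isEventuallyPeriodic : {c : ℕ → ℕ | IsEventuallyPeriodic c}.Countable := by
  have : {c : ℕ → ℕ | IsEventuallyPeriodic c} ⊆
      ⋃ x : ℕ × ℕ, {c | 0 < x.2 ∧ ∀ i, x.1 ≤ i → c (i + x.2) = c i} := by
    rintro c ⟨j, P, h⟩
    exact Set.mem_iUnion.2 ⟨(j, P), h⟩
  refine Set.Countable.mono this (Set.countable_iUnion fun ⟨j, P⟩ => ?_)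
  refine Set.MapsTo.countable_of_injOn (f := fun c (i : Fin (j + P)) => c i)
    (t := Set.univ) (fun _ _ => Set.mem_univ _) ?_ (Set.to_countable _)
  rintro c ⟨hP, hc⟩ d ⟨-, hd⟩ hcd
  simp only at hP hc hd
  funext i
  induction i using Nat.strong_induction_on with
  | _ i ih =>
    rcases lt_or_ge i (j + P) with h | h
    · exact congrFun hcd ⟨i, h⟩
    · have h1 := hc (i - P) (by omega)
      have h2 := hd (i - P) (by omega)
      rw [Nat.sub_add_cancel (by omega)] at h1 h2
      rw [h1, h2, ih _ (by omega)]

end Descent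

section KomornikLoretiBase

variable {p q : ℝ} {M : ℕ} {c d : ℕ → ℕ}

theorem klSeq_pos_infinite (hM : 0 < M) (k : ℕ) : ∃ i, 0 < klSeq M (i + k) := by
  have hlt : k < 2 ^ k := Nat.lt_two_pow_self
  refine ⟨2 ^ k - 1 - k, (klSeq_last hM (n := k) ?_).1⟩
  omega

theorem klSeq_shift_lexLe (hM : 0 < M) (k : ℕ) : LexLe (seqShift k (klSeq M)) (klSeq M) := by
  rcases Nat.eq_zero_or_pos k with rfl | hk
  · exact Or.inr rfl
  · exact Or.inl (klSeq_shift_lexLt hM hk)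

theorem seqVal_klSeq_shift_le (hM : 0 < M) (hp : 1 < p) (hpk : seqVal p (klSeq M) = 1) (k : ℕ) :
    seqVal p (seqShift k (klSeq M)) ≤ 1 :=
  seqVal_le_one_of_lexLe hp (klSeq_le hM) hpk (seqShift_le (klSeq_le hM) k) fun n => by
    rw [seqShift_seqShift]; exact klSeq_shift_lexLe hM _

theorem seqVal_klSeq_shift_lt (hM : 0 < M) (hp : 1 < p) (hpk : seqVal p (klSeq M) = 1) {k : ℕ}
    (hk : 0 < k) : seqVal p (seqShift k (klSeq M)) < 1 :=
  seqVal_lt_one_of_lexLt hp (klSeq_le hM) hpk (klSeq_pos_infinite hM) (seqShift_le (klSeq_le hM) k)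
    (fun n => by rw [seqShift_seqShift]; exact klSeq_shift_lexLe hM _) (klSeq_shift_lexLt hM hk)

theorem seqVal_klSeq_shift_conj_lt (hM : 0 < M) (hp : 1 < p) (hpk : seqVal p (klSeq M) = 1)
    (k : ℕ) : seqVal p (seqShift k (seqConj M (klSeq M))) < 1 :=
  seqVal_lt_one_of_lexLt hp (klSeq_le hM) hpk (klSeq_pos_infinite hM)
    (seqShift_le (fun _ => seqConj_le _) k)
    (fun n => by rw [seqShift_seqShift]; exact Or.inl (klSeq_shift_conj_lexLt hM _))
    (klSeq_shift_conj_lexLt hM k)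

theorem isUnivoqueSeq_klSeq (hM : 0 < M) (hp : 1 < p) (hpk : seqVal p (klSeq M) = 1) :
    IsUnivoqueSeq p M (klSeq M) :=
  IsUnivoqueSeq.of_forall_lt (klSeq_le hM) (fun n => seqVal_klSeq_shift_lt hM hp hpk n.succ_pos)
    fun n => seqVal_klSeq_shift_conj_lt hM hp hpk (n + 1)

/-- In a base below that of the Komornik–Loreti sequence, sequences of value at most `1` stay
below a fixed block of that sequence. -/
theorem exists_prefixLt_klSeq (hM : 0 < M) (hpk : seqVal p (klSeq M) = 1) (hq : 1 < q)
    (hqp : q < p) : ∃ n, ∀ d : ℕ → ℕ, (∀ i, d i ≤ M) → seqVal q d ≤ 1 →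
      PrefixLt (2 ^ n) d (klSeq M) := by
  have hp := hq.trans hqp
  have hk := klSeq_le hM
  have h1 : 1 < seqVal q (klSeq M) := by
    rw [← hpk]; exact seqVal_strictAnti_base hq hqp hk (i := 0) (by rwa [klSeq_zero])
  have h2 := (summable_seqVal hq hk).hasSum.tendsto_sum_nat
  obtain ⟨n, hn⟩ := (h2.eventually (lt_mem_nhds h1)).exists
  refine ⟨n, fun d hd hdv => ?_⟩
  have hagree : ¬ ∀ i < n, d i = klSeq M i := by
    intro hag
    have h3 := sum_le_seqVal hq hd n
    rw [Finset.sum_congr rfl fun i hi => by rw [hag i (Finset.mem_range.1 hi)]] at h3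
    linarith
  have hn2 : n < 2 ^ n := Nat.lt_two_pow_self
  rcases lexLt_trichotomy d (klSeq M) with ⟨k, hka, hkl⟩ | heq | ⟨k, hka, hkl⟩
  · refine ⟨k, ?_, hka, hkl⟩
    by_contra! hle
    exact hagree fun i hi => hka i (by omega)
  · exact absurd (fun i _ => congrFun heq i) hagree
  · exfalso
    have h3 := seqVal_sub_of_agree hp hk hd hka
    have h4 := seqVal_klSeq_shift_le hM hp hpk (k + 1)
    have h5 := seqVal_nonneg hp (seqShift (k + 1) d)
    have h6 : (klSeq M k : ℝ) + 1 ≤ d k := by exact_mod_cast hkl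
    have h7 := seqVal_strictAnti_base hq hqp hd (i := k) (by omega)
    rw [hpk] at h3
    have h8 : 0 < (1 - seqVal p d) * p ^ (k + 1) := by
      have : 0 < 1 - seqVal p d := by linarith
      positivity
    linarith

theorem IsUnivoqueSeq.isEventuallyPeriodic (hM : 0 < M) (hM2 : M ≤ 2)
    (hpk : seqVal p (klSeq M) = 1) (hq : 1 < q) (hqM : q ≤ M + 1) (hqp : q < p)
    (h : IsUnivoqueSeq q M c) : IsEventuallyPeriodic c := by
  by_cases h1 : ∃ n, c n < M
  · by_cases h2 : ∃ n, seqConj M c n < M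
    · obtain ⟨n, hn⟩ := h1
      obtain ⟨n', hn'⟩ := h2
      obtain ⟨m, hm⟩ := exists_prefixLt_klSeq hM hpk hq hqp
      refine IsEventuallyPeriodic.of_shift (k := n + n' + 1)
        (IsBlockBounded.isEventuallyPeriodic (n := m) hM hM2 ⟨seqShift_le h.le _, fun j => ?_,
          fun j => ?_⟩)
      · refine hm _ (seqShift_le (seqShift_le h.le _) _) ?_
        rw [seqShift_seqShift]
        exact (h.greedy.shift_lt_one hq hqM h.le hn (by omega)).le
      · refine hm _ (seqShift_le (fun _ => seqConj_le _) _) ?_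
        rw [← seqShift_seqConj, seqShift_seqShift]
        exact (h.lazy.shift_lt_one hq hqM (fun _ => seqConj_le _) hn' (by omega)).le
    · refine ⟨0, 1, one_pos, fun i _ => ?_⟩
      push Not at h2
      have e1 := h2 i
      have e2 := h2 (i + 1)
      simp only [seqConj] at e1 e2
      omega
  · push Not at h1
    exact ⟨0, 1, one_pos, fun i _ => ((h.le _).antisymm (h1 _)).trans
      ((h.le _).antisymm (h1 _)).symm⟩

theorem seqVal_const_eq_one_iff (hq : 1 < q) : seqVal q (fun _ => M) = 1 ↔ q = M + 1 := by
  have : q - 1 ≠ 0 := by linarith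
  rw [seqVal_const hq, div_eq_one_iff_eq this]
  constructor <;> intro h <;> linarith

/-- No univoque base with largest digit `M` lies below the Komornik–Loreti base. -/
theorem IsUnivoqueSeq.le_of_seqVal_eq_one (hM : 0 < M)
    (hpk : seqVal p (klSeq M) = 1) (hpM : p ≤ M + 1) (hq : 1 < q) (hMq : (M : ℝ) < q)
    (h : IsUnivoqueSeq q M c) (hc1 : seqVal q c = 1) : p ≤ q := by
  by_contra! hqp
  have hqM : q ≤ M + 1 := hqp.le.trans hpM
  obtain ⟨a, ha⟩ : ∃ n, c n < M := by
    by_contra! hall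
    have : c = fun _ => M := funext fun i => (h.le i).antisymm (hall i)
    rw [this, seqVal_const_eq_one_iff hq] at hc1
    linarith
  have h0 : c 0 = M := by
    by_contra hne
    have hlt : c 0 < M := lt_of_le_of_ne (h.le 0) hne
    have h1 := h.greedy 0 hlt
    have h2 := seqVal_eq_cons hq h.le
    rw [hc1, eq_div_iff (by linarith)] at h2
    have h3 : (c 0 : ℝ) + 1 ≤ M := by exact_mod_cast hlt
    simp only [zero_add] at h1
    linarith
  have htail := h.greedy.shift_le_one hq hqM h.le hc1.le
  obtain ⟨n, hn⟩ := exists_prefixLt_klSeq hM hpk hq hqp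
  have hbd : IsBlockBounded M n c := by
    refine ⟨h.le, fun j => hn _ (seqShift_le h.le j) (htail j), fun j => ?_⟩
    rcases Nat.eq_zero_or_pos j with rfl | hj
    · exact ⟨0, by positivity, by simp, by simp [seqShift, seqConj, h0, klSeq_zero, hM]⟩
    · exact hn _ (seqShift_le (fun _ => seqConj_le _) j)
        (h.lazy.shift_lt_one hq hqM (fun _ => seqConj_le _) (n := 0)
          (by simp [seqConj, h0, hM]) hj).le
  rcases hbd.exists_prefix hM with h' | ⟨m, j, hm, hj⟩
  · exact (h'.zero_lt 0).2.ne h0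
  have hper : ∀ b, (∀ i < 2 ^ m, seqShift b c i = klSeq M i) → ∀ l,
      seqShift (l * 2 ^ (m + 1) + b) c = seqShift b c := by
    intro b hb l
    rw [← seqShift_seqShift]
    induction l with
    | zero => rw [zero_mul, seqShift_zero]
    | succ l ih =>
      conv_rhs => rw [← ih]
      funext i
      have := (hm.shift b).periodic_of_prefix hM hb (i + l * 2 ^ (m + 1))
      simp only [seqShift] at this ⊢
      rw [← this]; congr 1; ring
  have hbig : a + 1 ≤ (a + 1) * 2 ^ (m + 1) := Nat.le_mul_of_pos_right _ (by positivity)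
  have hlt : ∀ b, (∀ i < 2 ^ m, seqShift b c i = klSeq M i) → seqVal q (seqShift b c) < 1 := by
    intro b hb
    rw [← hper b hb (a + 1)]
    exact h.greedy.shift_lt_one hq hqM h.le ha (by omega)
  rcases prefixLt_or_agree_of_prefixLt (L := 2 ^ m) (hm.lt 0) with h1 | h1
  · obtain ⟨k, hk, hka, hkl⟩ := h1
    rw [← hj k hk] at hkl
    have h2 := seqVal_sub_of_agree hq h.le (seqShift_le h.le j) (k := k)
      (fun i hi => (hka i hi).trans (hj i (hi.trans hk)).symm)
    have h3 := htail (k + 1)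
    have h4 := seqVal_nonneg hq (seqShift (k + 1) (seqShift j c))
    have h5 : (c k : ℝ) + 1 ≤ seqShift j c k := by exact_mod_cast hkl
    have h6 := hlt j hj
    have h7 : 0 < (seqVal q c - seqVal q (seqShift j c)) * q ^ (k + 1) := by
      have : 0 < seqVal q c - seqVal q (seqShift j c) := by linarith
      positivity
    linarith
  · have := hlt 0 h1
    rw [seqShift_zero, hc1] at this
    exact lt_irrefl _ this

end KomornikLoretiBase

section Existence

variable {p q : ℝ} {M : ℕ}

theorem continuousOn_seqVal {a : ℝ} (ha : 1 < a) {c : ℕ → ℕ} (hc : ∀ i, c i ≤ M) :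
    ContinuousOn (fun q => seqVal q c) (Set.Ici a) := by
  refine continuousOn_tsum (u := fun i => (c i : ℝ) / a ^ (i + 1)) (fun i => ?_)
    (summable_seqVal ha hc) fun i q hq => ?_
  · refine continuousOn_const.div (by fun_prop) fun q hq => ?_
    have : 0 < q := by have := Set.mem_Ici.1 hq; linarith
    positivity
  · have hq' : a ≤ q := hq
    have : 0 < q := by linarith
    rw [Real.norm_of_nonneg (by positivity)]
    gcongr

theorem klSeq_two (M : ℕ) : klSeq M 2 = 0 := by
  have := klSeq_add (M := M) (n := 1) (i := 0) (by norm_num)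
  simpa [klSeq_zero] using this

theorem klSeq_one (M : ℕ) : klSeq M 1 = 1 := by
  have := klSeq_add_last (M := M) (n := 0) (i := 0) (by norm_num)
  simpa [klSeq_zero] using this

/-- The base in which the Komornik–Loreti sequence represents `1`. -/
theorem exists_seqVal_klSeq_eq_one (hM : 0 < M) (hM2 : M ≤ 2) :
    ∃ p : ℝ, 1 < p ∧ (M : ℝ) < p ∧ p < M + 1 ∧ seqVal p (klSeq M) = 1 := by
  have hk := klSeq_le hM
  have hMr : (1 : ℝ) ≤ M := by exact_mod_cast hM
  have hupper : seqVal (M + 1 : ℝ) (klSeq M) < 1 := by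
    have h1 : (1 : ℝ) < M + 1 := by linarith
    have h2 := seqVal_conj h1 hk
    rw [add_sub_cancel_right, div_self (by linarith)] at h2
    have h3 := seqVal_pos h1 (fun _ => seqConj_le _) (c := seqConj M (klSeq M)) (i := 2)
      (by rw [seqConj, klSeq_two]; exact hM)
    linarith
  obtain ⟨a, ha1, haM, ha, hlower⟩ : ∃ a : ℝ, 1 < a ∧ (M : ℝ) ≤ a ∧ a ≤ M + 1 ∧
      1 < seqVal a (klSeq M) := by
    obtain rfl | rfl : M = 1 ∨ M = 2 := by omega
    · refine ⟨3 / 2, by norm_num, by norm_num, by norm_num, ?_⟩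
      refine lt_of_lt_of_le ?_ (sum_le_seqVal (by norm_num) hk 2)
      simp [Finset.sum_range_succ, klSeq_zero, klSeq_one]
      norm_num
    · refine ⟨2, by norm_num, by norm_num, by norm_num, ?_⟩
      refine lt_of_lt_of_le ?_ (sum_le_seqVal (by norm_num) hk 2)
      simp [Finset.sum_range_succ, klSeq_zero, klSeq_one]
  obtain ⟨p, ⟨hp1, hp2⟩, hp⟩ := intermediate_value_Icc' ha
    ((continuousOn_seqVal ha1 hk).mono Set.Icc_subset_Ici_self) ⟨hupper.le, hlower.le⟩
  have hne1 : a ≠ p := by rintro rfl; exact hlower.ne' hp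
  have hne2 : p ≠ M + 1 := by rintro rfl; exact hupper.ne hp
  have hap := lt_of_le_of_ne hp1 hne1
  exact ⟨p, ha1.trans hap, haM.trans_lt hap, lt_of_le_of_ne hp2 hne2, hp⟩

end Existence

section Continuum

variable {p q : ℝ} {M : ℕ}

theorem mk_Uq_eq_continuum (hq : 1 < q) {F : (ℕ → Bool) → ℕ → ℕ} (hF : Function.Injective F)
    {B : Set (ℕ → ℕ)} (hB : B.Countable)
    (h : ∀ x, F x ∉ B → IsUnivoqueSeq q (alphaOne q) (F x)) :
    Cardinal.mk (Uq q) = Cardinal.continuum := by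
  refine le_antisymm (Cardinal.mk_real ▸ Cardinal.mk_set_le _) ?_
  have hmk : Cardinal.mk (ℕ → Bool) = Cardinal.continuum := by simp
  have hc : (F ⁻¹' B).Countable := hB.preimage hF
  have hcompl : Cardinal.mk ((F ⁻¹' B)ᶜ : Set (ℕ → Bool)) = Cardinal.continuum := by
    rw [Cardinal.mk_compl_of_infinite, hmk]
    rw [hmk]
    exact hc.le_aleph0.trans_lt Cardinal.aleph0_lt_continuum
  rw [← hcompl]
  refine Cardinal.mk_le_of_injective
    (f := fun x => ⟨seqVal q (F x.1), (mem_Uq_iff hq).2 ⟨_, h x.1 x.2, rfl⟩⟩) fun x y hxy => ?_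
  exact Subtype.ext (hF ((h y.1 y.2).eq_of_seqVal_eq hq (h x.1 x.2).le (Subtype.ext_iff.1 hxy)))

theorem mk_Uq_of_two_lt_alphaOne (hq : 1 < q) (h : 2 < alphaOne q) :
    Cardinal.mk (Uq q) = Cardinal.continuum := by
  obtain ⟨m, hm⟩ := Nat.exists_eq_add_of_le' h
  have hlt := alphaOne_lt hq
  have hval : ∀ c : ℕ → ℕ, (∀ i, c i ≤ m + 2) → seqVal q c < 1 := by
    intro c hc
    refine (seqVal_le hq hc).trans_lt ?_
    rw [div_lt_one (by linarith)]
    rw [hm] at hlt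
    push_cast at hlt ⊢
    linarith
  refine mk_Uq_eq_continuum hq (F := fun x i => if x i then 1 else 2) (fun x y hxy => ?_)
    Set.countable_empty fun x _ => IsUnivoqueSeq.of_forall_lt (fun i => ?_)
      (fun n => hval _ fun i => ?_) (fun n => hval _ fun i => ?_)
  · funext i
    have h : (if x i then 1 else 2 : ℕ) = if y i then 1 else 2 := congrFun hxy i
    rw [Bool.eq_iff_iff]
    split_ifs at h <;> simp_all
  · split_ifs <;> omega
  · simp only [seqShift]; split_ifs <;> omega
  · simp only [seqShift, seqConj]; split_ifs <;> omega

theorem isClosed_setOf_seqVal_le (hp : 1 < p) (M : ℕ) :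
    IsClosed {c : ℕ → ℕ | (∀ i, c i ≤ M) ∧ seqVal p c ≤ 1} := by
  have h1 : {c : ℕ → ℕ | (∀ i, c i ≤ M) ∧ seqVal p c ≤ 1} =
      {c : ℕ → ℕ | ∀ i, c i ≤ M} ∩ {c | seqVal p (fun i => min (c i) M) ≤ 1} := by
    ext c
    refine and_congr_right fun hc => ?_
    have : (fun i => min (c i) M) = c := funext fun i => min_eq_left (hc i)
    rw [Set.mem_ofPred_eq, this]
  rw [h1]
  refine IsClosed.inter ?_ (isClosed_le ?_ continuous_const)
  · rw [Set.ofPred_forall]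
    exact isClosed_iInter fun i => isClosed_le (continuous_apply i) continuous_const
  · refine continuous_tsum (u := fun i => (M : ℝ) / p ^ (i + 1)) (fun i => ?_)
      (hasSum_const_div_pow hp (M : ℝ)).summable fun i c => ?_
    · have : Continuous fun c : ℕ → ℕ => ((min (c i) M : ℕ) : ℝ) :=
        continuous_of_discreteTopology.comp (f := fun c : ℕ → ℕ => c i)
          (g := fun n : ℕ => ((min n M : ℕ) : ℝ)) (continuous_apply i)
      exact this.div_const _
    · rw [Real.norm_of_nonneg (by positivity)]
      have : ((min (c i) M : ℕ) : ℝ) ≤ M := by exact_mod_cast min_le_right _ _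
      gcongr

theorem continuous_seqShift (k : ℕ) : Continuous (seqShift k) :=
  continuous_pi fun i => continuous_apply (i + k)

theorem continuous_seqConj (M : ℕ) : Continuous (seqConj M) :=
  continuous_pi fun i => (continuous_of_discreteTopology (f := fun n : ℕ => M - n)).comp
    (continuous_apply i)

theorem preperfect_klSeq_orbit (hM : 0 < M) :
    Preperfect (Set.range fun k => seqShift k (klSeq M)) := by
  rw [preperfect_iff_nhds]
  rintro _ ⟨k, rfl⟩ U hU
  have hlim : Filter.Tendsto (fun n => seqShift (3 * 2 ^ n + k) (klSeq M)) Filter.atTop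
      (nhds (seqShift k (klSeq M))) := by
    rw [tendsto_pi_nhds]
    intro i
    refine tendsto_const_nhds.congr' ?_
    filter_upwards [Filter.eventually_ge_atTop (i + k + 1)] with n hn
    have h1 : n < 2 ^ n := Nat.lt_two_pow_self
    rw [seqShift, ← klSeq_recurrent hM (n := n) (by omega), seqShift]
    congr 1; omega
  obtain ⟨n, hn⟩ := (hlim.eventually hU).exists
  exact ⟨_, ⟨hn, _, rfl⟩, (klSeq_shift_ne hM (by positivity)).symm⟩

theorem countable_setOf_shift_eq (d : ℕ → ℕ) : {c : ℕ → ℕ | ∃ n, seqShift n c = d}.Countable := by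
  rw [Set.ofPred_exists]
  refine Set.countable_iUnion fun n => ?_
  refine Set.MapsTo.countable_of_injOn (f := fun c (i : Fin n) => c i)
    (t := Set.univ) (fun _ _ => Set.mem_univ _) ?_ (Set.to_countable _)
  intro c hc c' hc' hcc
  funext i
  rcases lt_or_ge i n with h | h
  · exact congrFun hcc ⟨i, h⟩
  · have := congrFun ((show seqShift n c = d from hc).trans (show seqShift n c' = d from hc').symm)
      (i - n)
    simpa [seqShift, Nat.sub_add_cancel h] using this

theorem mk_Uq_of_klBase_le (hM : 0 < M) (hp : 1 < p) (hpk : seqVal p (klSeq M) = 1)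
    (hpq : p ≤ q) (hqM : alphaOne q = M) : Cardinal.mk (Uq q) = Cardinal.continuum := by
  have hq : 1 < q := hp.trans_le hpq
  let := TopologicalSpace.upgradeIsCompletelyMetrizable (ℕ → ℕ)
  obtain ⟨F, hFC, -, hF⟩ := (preperfect_klSeq_orbit hM).perfect_closure.exists_nat_bool_injection
    (Set.range_nonempty _).closure
  have hk := klSeq_le hM
  have hu := isUnivoqueSeq_klSeq hM hp hpk
  have hclos : ∀ c ∈ closure (Set.range fun k => seqShift k (klSeq M)), ∀ n,
      ((∀ i, seqShift n c i ≤ M) ∧ seqVal p (seqShift n c) ≤ 1) ∧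
      seqVal p (seqShift n (seqConj M c)) ≤ 1 := by
    intro c hc n
    have hcl := isClosed_setOf_seqVal_le hp M
    constructor
    · refine closure_minimal ?_ (hcl.preimage (continuous_seqShift n)) hc
      rintro _ ⟨k, rfl⟩
      rw [Set.mem_preimage, seqShift_seqShift]
      exact ⟨seqShift_le hk _, seqVal_klSeq_shift_le hM hp hpk _⟩
    · refine (closure_minimal ?_
        (hcl.preimage ((continuous_seqShift n).comp (continuous_seqConj M))) hc).2
      rintro _ ⟨k, rfl⟩
      rw [Set.mem_preimage, Function.comp_apply, ← seqShift_seqConj, seqShift_seqShift]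
      exact ⟨seqShift_le (fun _ => seqConj_le _) _, (seqVal_klSeq_shift_conj_lt hM hp hpk _).le⟩
  refine mk_Uq_eq_continuum hq hF
    ((countable_setOf_shift_eq (klSeq M)).union (countable_setOf_shift_eq (seqConj M (klSeq M))))
    fun x hx => ?_
  rw [hqM]
  have hx' := hclos _ (hFC ⟨x, rfl⟩)
  have hle : ∀ i, F x i ≤ M := (hx' 0).1.1
  simp only [Set.mem_union, Set.mem_ofPred_eq, not_or, not_exists] at hx
  refine IsUnivoqueSeq.of_forall_lt hle (fun n => ?_) fun n => ?_
  · refine (seqVal_anti_base hp hpq (seqShift_le hle _)).trans_lt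
      (lt_of_le_of_ne (hx' _).1.2 fun heq => hx.1 (n + 1) ?_)
    exact hu.eq_of_seqVal_eq hp (seqShift_le hle _) (heq.trans hpk.symm)
  · refine (seqVal_anti_base hp hpq (seqShift_le (fun _ => seqConj_le _) _)).trans_lt
      (lt_of_le_of_ne (hx' _).2 fun heq => hx.2 (n + 1) ?_)
    rw [← hu.eq_of_seqVal_eq hp (seqShift_le (fun _ => seqConj_le _) _) (heq.trans hpk.symm),
      seqShift_seqConj, seqConj_seqConj (seqShift_le hle _)]

end Continuum

section SmallBases

variable {p q : ℝ} {M : ℕ} {c : ℕ → ℕ}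

theorem isUnivoqueSeq_zero (q : ℝ) (M : ℕ) : IsUnivoqueSeq q M (fun _ => 0) :=
  ⟨fun _ => Nat.zero_le _, fun n _ => by simp [seqShift, seqVal],
    fun n hn => by simp [seqConj] at hn⟩

theorem isUnivoqueSeq_max (q : ℝ) (M : ℕ) : IsUnivoqueSeq q M (fun _ => M) := by
  simpa [seqConj] using! (isUnivoqueSeq_zero q M).conj

theorem IsUnivoqueSeq.not_step_up (hq : 1 < q) (hG : q * (q - 1) ≤ 1) (h : IsUnivoqueSeq q 1 c)
    {n : ℕ} (h0 : c n = 0) (h1 : c (n + 1) = 1) : False := by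
  have e1 := h.greedy n (by omega)
  have e2 := h.lazy (n + 1) (by simp [seqConj, h1])
  have e3 := seqVal_eq_cons hq (seqShift_le h.le (n + 1))
  rw [seqShift_seqShift, add_comm 1, show seqShift (n + 1) c 0 = 1 by simpa [seqShift] using h1,
    eq_div_iff (by linarith)] at e3
  rw [seqShift_seqConj, seqVal_conj hq (seqShift_le h.le _)] at e2
  push_cast at e2 e3
  have hq1 : 0 < q - 1 := by linarith
  have e4 : 1 / (q - 1) < q := by nlinarith
  rw [div_lt_iff₀ hq1] at e4
  linarith

theorem IsUnivoqueSeq.eq_const (hq : 1 < q) (hG : q * (q - 1) ≤ 1) (h : IsUnivoqueSeq q 1 c) :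
    (c = fun _ => 0) ∨ c = fun _ => 1 := by
  have hstep : ∀ n, c (n + 1) = c n := by
    intro n
    have l1 := h.le n
    have l2 := h.le (n + 1)
    by_contra hne
    rcases (show c n = 0 ∨ c n = 1 by omega) with h0 | h0
    · exact h.not_step_up hq hG h0 (by omega)
    · exact h.conj.not_step_up hq hG (n := n) (by simp [seqConj, h0]) (by simp only [seqConj]; omega)
  have hconst : ∀ n, c n = c 0 := fun n => by
    induction n with
    | zero => rfl
    | succ n ih => rw [hstep, ih]
  have l0 := h.le 0
  rcases (show c 0 = 0 ∨ c 0 = 1 by omega) with h0 | h0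
  · exact Or.inl (funext fun n => (hconst n).trans h0)
  · exact Or.inr (funext fun n => (hconst n).trans h0)

theorem Uq_eq_of_le_golden (hq : 1 < q) (hG : q * (q - 1) ≤ 1) (hqM : alphaOne q = 1) :
    Uq q = {0, (alphaOne q : ℝ) / (q - 1)} := by
  ext x
  rw [mem_Uq_iff hq, hqM, ← seqVal_const hq, Set.mem_insert_iff, Set.mem_singleton_iff]
  have hz : seqVal q (fun _ => 0) = 0 := by simp [seqVal]
  constructor
  · rintro ⟨c, hc, rfl⟩
    rcases hc.eq_const hq hG with rfl | rfl
    · exact Or.inl hz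
    · exact Or.inr rfl
  · rintro (rfl | rfl)
    · exact ⟨_, isUnivoqueSeq_zero q 1, hz⟩
    · exact ⟨_, isUnivoqueSeq_max q 1, rfl⟩

theorem div_mem_Uq (hq : 1 < q) {x : ℝ} (hx : x ∈ Uq q) (hx1 : x < 1) : x / q ∈ Uq q := by
  obtain ⟨c, hc, rfl⟩ := (mem_Uq_iff hq).1 hx
  refine (mem_Uq_iff hq).2 ⟨fun n => n.casesOn 0 c, ⟨?_, ?_, ?_⟩, ?_⟩
  · rintro (_ | n)
    · exact Nat.zero_le _
    · exact hc.le n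
  · rintro (_ | n) hn
    · exact hx1
    · exact hc.greedy n hn
  · rintro (_ | n) hn
    · simp [seqConj] at hn
    · exact hc.lazy n hn
  · rw [seqVal_eq_cons (M := alphaOne q) hq]
    · change (((0 : ℕ) : ℝ) + seqVal q c) / q = seqVal q c / q
      rw [Nat.cast_zero, zero_add]
    · rintro (_ | n)
      · exact Nat.zero_le _
      · exact hc.le n

theorem infinite_Uq_of_mem (hq : 1 < q) {x : ℝ} (hx : x ∈ Uq q) (hx0 : 0 < x) (hx1 : x < 1) :
    (Uq q).Infinite := by
  have hmem : ∀ k : ℕ, x / q ^ k ∈ Uq q ∧ x / q ^ k < 1 := by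
    intro k
    induction k with
    | zero => simpa using ⟨hx, hx1⟩
    | succ k ih =>
      rw [pow_succ, ← div_div]
      refine ⟨div_mem_Uq hq ih.1 ih.2, ?_⟩
      exact (div_lt_self (by positivity) hq).trans ih.2
  refine Set.infinite_of_injective_forall_mem (f := fun k : ℕ => x / q ^ k) (fun a b hab => ?_)
    fun k => (hmem k).1
  have hpa : q ^ a ≠ 0 := by positivity
  have hpb : q ^ b ≠ 0 := by positivity
  have hab' : x / q ^ a = x / q ^ b := hab
  rw [div_eq_div_iff hpa hpb] at hab'
  exact (pow_right_injective₀ (by linarith) hq.ne' (mul_left_cancel₀ hx0.ne' hab')).symm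

theorem infinite_Uq_of_golden_lt (hq : 1 < q) (hG : 1 < q * (q - 1)) (hqM : alphaOne q = 1) :
    (Uq q).Infinite := by
  let c : ℕ → ℕ := fun i => (i + 1) % 2
  have hc : ∀ i, c i ≤ 1 := fun i => by simp only [c]; omega
  have hcc : seqConj 1 c = seqShift 1 c := by
    funext i; simp only [c, seqConj, seqShift]; omega
  have hc2 : seqShift 1 (seqShift 1 c) = c := by
    funext i; simp only [c, seqShift]; omega
  have e1 := seqVal_eq_cons hq hc
  have e2 := seqVal_eq_cons hq (seqShift_le hc 1)
  rw [hc2] at e2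
  rw [eq_div_iff (by linarith)] at e1 e2
  simp only [c, seqShift] at e1 e2
  norm_num at e1 e2
  have hc1 : seqVal q c < 1 := by
    by_contra! hge
    change seqVal q c * q = 1 + seqVal q (seqShift 1 c) at e1
    change seqVal q (seqShift 1 c) * q = seqVal q c at e2
    nlinarith
  have hs : seqVal q (seqShift 1 c) < 1 := by
    change seqVal q (seqShift 1 c) * q = seqVal q c at e2
    nlinarith [seqVal_nonneg hq (seqShift 1 c)]
  have hall : ∀ n, seqShift n c = c ∨ seqShift n c = seqShift 1 c := by
    intro n
    rcases Nat.even_or_odd' n with ⟨m, rfl | rfl⟩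
    · left; funext i; simp only [c, seqShift]; omega
    · right; funext i; simp only [c, seqShift]; omega
  refine infinite_Uq_of_mem hq (x := seqVal q c) ((mem_Uq_iff hq).2 ⟨c, ?_, rfl⟩)
    (seqVal_pos hq hc (i := 0) (by simp [c])) hc1
  rw [hqM]
  refine IsUnivoqueSeq.of_forall_lt hc (fun n => ?_) fun n => ?_
  · rcases hall (n + 1) with h | h <;> rw [h] <;> assumption
  · rw [hcc, seqShift_seqShift]
    rcases hall (n + 1 + 1) with h | h <;> rw [h] <;> assumption

theorem infinite_Uq_of_alphaOne_eq_two (hq : 1 < q) (hqM : alphaOne q = 2) :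
    (Uq q).Infinite := by
  have hq2 : 2 < q := by have := alphaOne_lt hq; rw [hqM] at this; exact_mod_cast this
  have hval : seqVal q (fun _ => 1) < 1 := by
    rw [seqVal_const hq, div_lt_one (by linarith)]; push_cast; linarith
  refine infinite_Uq_of_mem hq (x := seqVal q fun _ => 1) ((mem_Uq_iff hq).2 ⟨_, ?_, rfl⟩)
    (seqVal_pos hq (fun _ => le_rfl) (i := 0) one_pos) hval
  rw [hqM]
  exact IsUnivoqueSeq.of_forall_lt (fun _ => one_le_two) (fun _ => hval) fun _ => hval

theorem countable_Uq_of_lt_klBase (hM : 0 < M) (hM2 : M ≤ 2) (hpk : seqVal p (klSeq M) = 1)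
    (hq : 1 < q) (hqp : q < p) (hqM : alphaOne q = M) : (Uq q).Countable := by
  refine (countable_setOf_isEventuallyPeriodic.image (seqVal q)).mono fun x hx => ?_
  obtain ⟨c, hc, rfl⟩ := (mem_Uq_iff hq).1 hx
  have hle := le_alphaOne_add_one q
  rw [hqM] at hc hle
  exact ⟨c, hc.isEventuallyPeriodic hM hM2 hpk hq hle hqp, rfl⟩

end SmallBases

theorem mem_USet_of_seqVal_klSeq_eq_one {p : ℝ} {M : ℕ} (hM : 0 < M) (hp : 1 < p)
    (hMp : (M : ℝ) < p) (hpM : p ≤ M + 1) (hpk : seqVal p (klSeq M) = 1) : p ∈ USet :=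
  ⟨hp, (mem_Uq_iff hp).2
    ⟨klSeq M, by rw [alphaOne_eq hMp hpM]; exact isUnivoqueSeq_klSeq hM hp hpk, hpk⟩⟩

theorem klBase_le_of_mem_USet {p q : ℝ} {M : ℕ} (hM : 0 < M) (hpM : p ≤ M + 1)
    (hpk : seqVal p (klSeq M) = 1) (hMq : (M : ℝ) < q) (hq : q ∈ USet) : p ≤ q := by
  by_contra! hqp
  obtain ⟨c, hc, hc1⟩ := (mem_Uq_iff hq.1).1 hq.2
  rw [alphaOne_eq hMq (hqp.le.trans hpM)] at hc
  exact (hc.le_of_seqVal_eq_one hM hpk hpM hq.1 hMq hc1).not_gt hqp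

/-- cardinality of `U_q`. -/
theorem card_Uq (q' q'' : ℝ) (hq' : IsLeast USet q')
    (hq'' : IsLeast (USet ∩ Set.Ioo 2 3) q'') :
    ∀ q : ℝ, 1 < q →
      (q ∈ Set.Ioc 1 ((1 + Real.sqrt 5) / 2) →
        Uq q = {0, (alphaOne q : ℝ) / (q - 1)}) ∧
      (q ∈ Set.Ioo ((1 + Real.sqrt 5) / 2) q' ∪ Set.Ioo 2 q'' →
        (Uq q).Countable ∧ (Uq q).Infinite) ∧
      (q ∈ Set.Icc q' 2 ∪ Set.Ici q'' →
        Cardinal.mk (Uq q) = Cardinal.continuum) := by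
  obtain ⟨p₁, hp₁, -, hp₁2, hk₁⟩ := exists_seqVal_klSeq_eq_one (M := 1) one_pos one_le_two
  obtain ⟨p₂, hp₂, hp₂2, hp₂3, hk₂⟩ := exists_seqVal_klSeq_eq_one (M := 2) two_pos le_rfl
  have e₁ : q' = p₁ := le_antisymm
    (hq'.2 (mem_USet_of_seqVal_klSeq_eq_one one_pos hp₁ (by exact_mod_cast hp₁) hp₁2.le hk₁))
    (klBase_le_of_mem_USet one_pos hp₁2.le hk₁ (by exact_mod_cast hq'.1.1) hq'.1)
  have e₂ : q'' = p₂ := by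
    refine le_antisymm (hq''.2 ⟨mem_USet_of_seqVal_klSeq_eq_one two_pos hp₂ hp₂2 hp₂3.le hk₂, ?_⟩)
      (klBase_le_of_mem_USet two_pos hp₂3.le hk₂ (by exact_mod_cast hq''.1.2.1) hq''.1.1)
    push_cast at hp₂2 hp₂3
    exact ⟨hp₂2, by linarith⟩
  subst e₁ e₂
  push_cast at hp₁2 hp₂2 hp₂3
  have hsq : Real.sqrt 5 ^ 2 = 5 := Real.sq_sqrt (by norm_num)
  have hs0 := Real.sqrt_nonneg 5
  have hone : ∀ q : ℝ, 1 < q → q ≤ 2 → alphaOne q = 1 := fun q h1 h2 =>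
    alphaOne_eq (by exact_mod_cast h1) (by push_cast; linarith)
  have htwo : ∀ q : ℝ, 2 < q → q ≤ 3 → alphaOne q = 2 := fun q h1 h2 =>
    alphaOne_eq (by exact_mod_cast h1) (by push_cast; linarith)
  intro q hq
  refine ⟨fun h => ?_, ?_, ?_⟩
  · have h2 := h.2
    have hG : q * (q - 1) ≤ 1 := by nlinarith
    exact Uq_eq_of_le_golden hq hG (hone q hq (by nlinarith))
  · rintro (⟨h1, h2⟩ | ⟨h1, h2⟩)
    · have hα := hone q hq (by linarith)
      exact ⟨countable_Uq_of_lt_klBase one_pos one_le_two hk₁ hq h2 hα,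
        infinite_Uq_of_golden_lt hq (by nlinarith) hα⟩
    · have hα := htwo q h1 (by linarith)
      exact ⟨countable_Uq_of_lt_klBase two_pos le_rfl hk₂ hq h2 hα,
        infinite_Uq_of_alphaOne_eq_two hq hα⟩
  · rintro (⟨h1, h2⟩ | h1)
    · exact mk_Uq_of_klBase_le one_pos hp₁ hk₁ h1 (hone q hq h2)
    · rw [Set.mem_Ici] at h1
      rcases le_or_gt q 3 with h3 | h3
      · exact mk_Uq_of_klBase_le two_pos hp₂ hk₂ h1 (htwo q (by linarith) h3)
      · refine mk_Uq_of_two_lt_alphaOne hq ?_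
        have h4 := le_alphaOne_add_one q
        have : (2 : ℝ) < alphaOne q := by linarith
        exact_mod_cast this
end
end

section
/- Let q > 1 be a real number, let m = ⌈q⌉ − 1, and let x ∈ (0, m/(q−1)]. Define a sequence (a_n) of integers recursively by: a_n is the largest element of {0, 1, …, m} such that ∑_{i=1}^n a_i q^{−i} < x. Then x = ∑_{i=1}^∞ a_i q^{−i}. -/
open Classical

noncomputable section

/-- The largest digit satisfies `q - 1 ≤ α₁`. -/
theorem sub_one_le_alphaOne (q : ℝ) : q - 1 ≤ (alphaOne q : ℝ) := by
  have h : ((⌈q⌉ - 1 : ℤ) : ℝ) ≤ ((alphaOne q : ℤ) : ℝ) := by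
    exact_mod_cast Int.self_le_toNat (⌈q⌉ - 1)
  push_cast at h
  linarith [Int.le_ceil q]

/-- The remainder after `n` steps of the quasi-greedy algorithm is at most
`α₁ / (q - 1) / q ^ n`. -/
theorem quasiGreedy_remainder_le {q : ℝ} (hq : 1 < q) {x : ℝ}
    (hx : x ≤ (alphaOne q : ℝ) / (q - 1)) {a : ℕ → ℕ}
    (ha : ∀ n, IsGreatest
      {d : ℕ | d ≤ alphaOne q ∧
        (∑ i ∈ Finset.range n, (a i : ℝ) / q ^ (i + 1)) + (d : ℝ) / q ^ (n + 1) < x}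
      (a n)) (n : ℕ) :
    x - ∑ i ∈ Finset.range n, (a i : ℝ) / q ^ (i + 1) ≤
      (alphaOne q : ℝ) / (q - 1) / q ^ n := by
  have hq0 : 0 < q := by linarith
  have hq1 : 0 < q - 1 := by linarith
  induction n with
  | zero => simpa using hx
  | succ n ih =>
    rw [Finset.sum_range_succ]
    have hpos : 0 < q ^ (n + 1) := by positivity
    rcases (ha n).1.1.eq_or_lt with hmax | hlt
    · rw [hmax]
      have key : (alphaOne q : ℝ) / (q - 1) / q ^ n - (alphaOne q : ℝ) / q ^ (n + 1) =
          (alphaOne q : ℝ) / (q - 1) / q ^ (n + 1) := by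
        field_simp
        ring
      linarith
    · have hstep : x ≤ (∑ i ∈ Finset.range n, (a i : ℝ) / q ^ (i + 1)) +
          ((a n + 1 : ℕ) : ℝ) / q ^ (n + 1) := by
        by_contra! h
        exact absurd ((ha n).2 ⟨hlt, h⟩) (by simp)
      have hbound : 1 / q ^ (n + 1) ≤ (alphaOne q : ℝ) / (q - 1) / q ^ (n + 1) := by
        gcongr
        rw [one_le_div hq1]
        exact sub_one_le_alphaOne q
      push_cast at hstep
      rw [add_div] at hstep
      linarith

/-- the quasi-greedy algorithm produces an expansion.
If `a_n` is at each step the largest digit in `{0, …, m}` keeping the partial sum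
strictly below `x`, then `x = ∑ a_i q^{-i}`. -/
theorem quasiGreedy_algorithm (q : ℝ) (hq : 1 < q) (x : ℝ)
    (hx : x ∈ Set.Ioc 0 ((alphaOne q : ℝ) / (q - 1))) (a : ℕ → ℕ)
    (ha : ∀ n, IsGreatest
      {d : ℕ | d ≤ alphaOne q ∧
        (∑ i ∈ Finset.range n, (a i : ℝ) / q ^ (i + 1)) + (d : ℝ) / q ^ (n + 1) < x}
      (a n)) :
    x = ∑' i, (a i : ℝ) / q ^ (i + 1) := by
  have hq0 : 0 < q := by linarith
  have hlim : Filter.Tendsto (fun n : ℕ => (alphaOne q : ℝ) / (q - 1) / q ^ n)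
      Filter.atTop (nhds 0) :=
    (tendsto_pow_atTop_atTop_of_one_lt hq).const_div_atTop _
  have hrem : Filter.Tendsto
      (fun n : ℕ => x - ∑ i ∈ Finset.range n, (a i : ℝ) / q ^ (i + 1))
      Filter.atTop (nhds 0) := by
    refine squeeze_zero (fun n => ?_) (quasiGreedy_remainder_le hq hx.2 ha) hlim
    have hlt := (ha n).1.2
    have hnonneg : 0 ≤ (a n : ℝ) / q ^ (n + 1) := by positivity
    linarith
  have hsum : HasSum (fun i => (a i : ℝ) / q ^ (i + 1)) x := by
    rw [hasSum_iff_tendsto_nat_of_nonneg (fun i => by positivity)]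
    simpa using hrem.const_sub x
  exact hsum.tsum_eq.symm
end
end

section
/- The map q ↦ (α_i(q)), assigning to each real number q > 1 the quasi-greedy expansion of 1 in base q, is a strictly increasing bijection from the open interval (1, ∞) onto the set of all infinite sequences (α_i)_{i≥1} of nonnegative integers satisfying, for every k ≥ 1, that the shifted sequence (α_{k+i})_{i≥1} is lexicographically at most (α_i)_{i≥1}. Here strictly increasing means: if 1 < q < r then (α_i(q)) is lexicographically strictly smaller than (α_i(r)). -/
open Classical

noncomputable section

/-- The value `∑_{i≥1} c_i q^{-i}` of a digit sequence in base `q`. -/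
def baseSum (q : ℝ) (c : ℕ → ℕ) : ℝ := ∑' i, (c i : ℝ) / q ^ (i + 1)

/-- The leading digit chosen by the quasi-greedy algorithm at `x`. -/
def quasiDigit (q x : ℝ) : ℕ := ⌈q * x⌉₊ - 1

/-- The remainder map of the quasi-greedy algorithm. -/
def quasiStep (q x : ℝ) : ℝ := q * x - quasiDigit q x

/-- The digit sequence produced by the quasi-greedy algorithm started at `x`. -/
def quasiSeq (q x : ℝ) (n : ℕ) : ℕ := quasiDigit q ((quasiStep q)^[n] x)

theorem lexLt_trichotomy_s15 (a b : ℕ → ℕ) : LexLt a b ∨ a = b ∨ LexLt b a := by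
  by_cases h : a = b
  · exact Or.inr (Or.inl h)
  have h' : ∃ n, a n ≠ b n := Function.ne_iff.mp h
  have hmin : ∀ i, i < Nat.find h' → a i = b i := fun i hi => not_not.mp (Nat.find_min h' hi)
  rcases lt_or_gt_of_ne (Nat.find_spec h') with hlt | hgt
  · exact Or.inl ⟨_, hmin, hlt⟩
  · exact Or.inr (Or.inr ⟨_, fun i hi => (hmin i hi).symm, hgt⟩)

theorem LexLt.asymm {a b : ℕ → ℕ} (hab : LexLt a b) : ¬ LexLt b a := by
  rintro ⟨m, hm, hm'⟩
  obtain ⟨n, hn, hn'⟩ := hab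
  rcases lt_trichotomy m n with h | h | h
  · exact hm'.ne' (hn m h)
  · subst h
    exact hm'.asymm hn'
  · exact hn'.ne' (hm n h)

theorem lexLe_of_not_lexLt {a b : ℕ → ℕ} (h : ¬ LexLt b a) : LexLe a b := by
  rcases lexLt_trichotomy_s15 a b with h' | h' | h'
  · exact Or.inl h'
  · exact Or.inr h'
  · exact absurd h' h

theorem LexLe.antisymm {a b : ℕ → ℕ} (hab : LexLe a b) (hba : LexLe b a) : a = b := by
  rcases hab with hab | hab
  · rcases hba with hba | hba
    · exact absurd hba hab.asymm
    · exact hba.symm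
  · exact hab

theorem LexLe.apply_zero_le {a b : ℕ → ℕ} (h : LexLe a b) : a 0 ≤ b 0 := by
  rcases h with ⟨n, hn, hlt⟩ | h
  · rcases n.eq_zero_or_pos with h0 | h0
    · exact h0 ▸ hlt.le
    · exact (hn 0 h0).le
  · rw [h]

theorem InfiniteSeq.exists_ge {c : ℕ → ℕ} (h : InfiniteSeq c) (n : ℕ) : ∃ i, n ≤ i ∧ c i ≠ 0 := by
  obtain ⟨i, hi, hni⟩ := Set.Infinite.exists_gt h n
  exact ⟨i, hni.le, hi⟩

/-- A bounded family whose positive values are dominated by `q⁻¹` times other values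
is nonpositive. -/
theorem nonpos_of_contracting {q C : ℝ} (hq : 1 < q) {u : ℕ → ℝ} (hC : ∀ k, u k ≤ C)
    (hu : ∀ k, u k ≤ 0 ∨ ∃ j, u k ≤ u j / q) (k : ℕ) : u k ≤ 0 := by
  have hq0 : 0 < q := zero_lt_one.trans hq
  have key : ∀ m k, u k ≤ max C 0 / q ^ m := by
    intro m
    induction m with
    | zero => intro k; simpa using Or.inl (hC k)
    | succ m ih =>
      intro k
      rcases hu k with h | ⟨j, h⟩
      · exact h.trans (by positivity)
      · calc u k ≤ u j / q := h
          _ ≤ max C 0 / q ^ m / q := by gcongr; exact ih j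
          _ = max C 0 / q ^ (m + 1) := by rw [div_div, pow_succ]
  have hlim : Filter.Tendsto (fun m : ℕ => max C 0 / q ^ m) Filter.atTop (nhds 0) :=
    (tendsto_pow_atTop_atTop_of_one_lt hq).const_div_atTop _
  exact ge_of_tendsto' hlim fun m => key m k

theorem hasSum_const_div_pow_succ {q : ℝ} (hq : 1 < q) (M : ℝ) :
    HasSum (fun i : ℕ => M / q ^ (i + 1)) (M / (q - 1)) := by
  have hq0 : 0 < q := zero_lt_one.trans hq
  have h := (hasSum_geometric_of_lt_one (inv_nonneg.mpr hq0.le) (inv_lt_one_of_one_lt₀ hq)).mul_left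
    (M / q)
  have hterm : (fun i : ℕ => M / q ^ (i + 1)) = fun i => M / q * q⁻¹ ^ i := by
    ext i
    rw [pow_succ, inv_pow]
    field_simp
  have hval : M / (q - 1) = M / q * (1 - q⁻¹)⁻¹ := by
    have : 1 - q⁻¹ = (q - 1) / q := by field_simp
    rw [this, inv_div]
    field_simp
  rwa [hterm, hval]

theorem summable_digits {q : ℝ} (hq : 1 < q) {c : ℕ → ℕ} {M : ℕ} (hc : ∀ i, c i ≤ M) :
    Summable fun i => (c i : ℝ) / q ^ (i + 1) := by
  have hq0 : 0 < q := zero_lt_one.trans hq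
  refine Summable.of_nonneg_of_le (fun i => by positivity) (fun i => ?_)
    (hasSum_const_div_pow_succ hq M).summable
  gcongr
  exact_mod_cast hc i

theorem baseSum_le {q : ℝ} (hq : 1 < q) {c : ℕ → ℕ} {M : ℕ} (hc : ∀ i, c i ≤ M) :
    baseSum q c ≤ M / (q - 1) := by
  have hq0 : 0 < q := zero_lt_one.trans hq
  rw [← (hasSum_const_div_pow_succ hq (M : ℝ)).tsum_eq]
  refine (summable_digits hq hc).tsum_le_tsum (fun i => ?_)
    (hasSum_const_div_pow_succ hq (M : ℝ)).summable
  gcongr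
  exact_mod_cast hc i

theorem baseSum_nonneg {q : ℝ} (hq : 1 < q) (c : ℕ → ℕ) : 0 ≤ baseSum q c :=
  have hq0 : 0 < q := zero_lt_one.trans hq
  tsum_nonneg fun i => by positivity

theorem baseSum_pos {q : ℝ} (hq : 1 < q) {c : ℕ → ℕ} {M : ℕ} (hc : ∀ i, c i ≤ M) {i : ℕ}
    (hi : c i ≠ 0) : 0 < baseSum q c := by
  have hq0 : 0 < q := zero_lt_one.trans hq
  refine (summable_digits hq hc).tsum_pos (fun i => by positivity) i ?_
  have : (0 : ℝ) < c i := by exact_mod_cast Nat.pos_of_ne_zero hi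
  positivity

theorem mul_baseSum {q : ℝ} (hq : 1 < q) {c : ℕ → ℕ} {M : ℕ} (hc : ∀ i, c i ≤ M) :
    q * baseSum q c = c 0 + baseSum q fun i => c (i + 1) := by
  have hq0 : 0 < q := zero_lt_one.trans hq
  unfold baseSum
  rw [(summable_digits hq hc).tsum_eq_zero_add, mul_add, ← tsum_mul_left]
  congr 1
  · rw [zero_add, pow_one, mul_div_cancel₀ _ hq0.ne']
  · congr 1
    ext i
    rw [pow_succ q (i + 1)]
    field_simp

theorem baseSum_sub_baseSum {q : ℝ} (hq : 1 < q) (n : ℕ) : ∀ {c d : ℕ → ℕ} {M : ℕ},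
    (∀ i, c i ≤ M) → (∀ i, d i ≤ M) → (∀ i, i < n → c i = d i) →
    q ^ n * (baseSum q c - baseSum q d) =
      baseSum q (fun i => c (n + i)) - baseSum q (fun i => d (n + i)) := by
  induction n with
  | zero => intros; simp
  | succ n ih =>
    intro c d M hc hd h
    have hs := ih (c := fun i => c (i + 1)) (d := fun i => d (i + 1)) (fun i => hc _)
      (fun i => hd _) fun i hi => h _ (by omega)
    have e : q ^ (n + 1) * (baseSum q c - baseSum q d) =
        q ^ n * (baseSum q (fun i => c (i + 1)) - baseSum q (fun i => d (i + 1))) := by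
      rw [pow_succ, mul_assoc, mul_sub, mul_baseSum hq hc, mul_baseSum hq hd, h 0 (by omega)]
      ring
    rw [e, hs]
    simp only [add_right_comm n _ 1]

theorem quasiDigit_add_one {q x : ℝ} (hq : 0 < q) (hx : 0 < x) :
    quasiDigit q x + 1 = ⌈q * x⌉₊ :=
  Nat.sub_add_cancel (Nat.ceil_pos.mpr (mul_pos hq hx))

theorem mul_le_quasiDigit_add_one {q x : ℝ} (hq : 0 < q) (hx : 0 < x) :
    q * x ≤ quasiDigit q x + 1 := by
  have h := Nat.le_ceil (q * x)
  rw [← quasiDigit_add_one hq hx] at h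
  exact_mod_cast h

theorem quasiDigit_lt_mul {q x : ℝ} (hq : 0 < q) (hx : 0 < x) : quasiDigit q x < q * x := by
  rw [← Nat.lt_ceil, ← quasiDigit_add_one hq hx]
  exact Nat.lt_succ_self _

theorem quasiStep_mem {q x : ℝ} (hq : 0 < q) (hx : 0 < x) :
    quasiStep q x ∈ Set.Ioc (0 : ℝ) 1 := by
  have h1 := quasiDigit_lt_mul hq hx
  have h2 := mul_le_quasiDigit_add_one hq hx
  unfold quasiStep
  constructor <;> linarith

theorem quasiDigit_eq {q x : ℝ} {d : ℕ} (h : q * x - d ∈ Set.Ioc (0 : ℝ) 1) :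
    quasiDigit q x = d := by
  have : ⌈q * x⌉₊ = d + 1 := by
    rw [Nat.ceil_eq_iff (Nat.succ_ne_zero d)]
    push_cast
    constructor <;> linarith [h.1, h.2]
  simp [quasiDigit, this]

theorem iterate_quasiStep_mem {q x : ℝ} (hq : 0 < q) (hx : x ∈ Set.Ioc (0 : ℝ) 1) (n : ℕ) :
    (quasiStep q)^[n] x ∈ Set.Ioc (0 : ℝ) 1 := by
  induction n with
  | zero => exact hx
  | succ n ih =>
    rw [Function.iterate_succ_apply']
    exact quasiStep_mem hq ih.1

theorem quasiDigit_le_alphaOne {q x : ℝ} (hq : 0 < q) (hx : x ≤ 1) :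
    quasiDigit q x ≤ alphaOne q := by
  have h : ⌈q * x⌉₊ ≤ ⌈q⌉₊ := Nat.ceil_mono (mul_le_of_le_one_right hq.le hx)
  have h' : ((⌈q⌉₊ : ℕ) : ℤ) = ⌈q⌉ := Int.natCast_ceil_eq_ceil hq.le
  unfold quasiDigit alphaOne
  omega

theorem quasiSeq_le_alphaOne {q x : ℝ} (hq : 0 < q) (hx : x ∈ Set.Ioc (0 : ℝ) 1) (n : ℕ) :
    quasiSeq q x n ≤ alphaOne q :=
  quasiDigit_le_alphaOne hq (iterate_quasiStep_mem hq hx n).2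

theorem quasiSeq_shift (q x : ℝ) (n : ℕ) :
    (fun i => quasiSeq q x (n + i)) = quasiSeq q ((quasiStep q)^[n] x) := by
  ext i
  rw [quasiSeq, quasiSeq, add_comm, Function.iterate_add_apply]

theorem quasiSeq_succ (q x : ℝ) :
    (fun i => quasiSeq q x (i + 1)) = quasiSeq q (quasiStep q x) := rfl

theorem baseSum_quasiSeq {q x : ℝ} (hq : 1 < q) (hx : x ∈ Set.Ioc (0 : ℝ) 1) :
    baseSum q (quasiSeq q x) = x := by
  have hq0 : 0 < q := zero_lt_one.trans hq
  set R : ℕ → ℝ := fun n => (quasiStep q)^[n] x with hR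
  have hmem : ∀ n, R n ∈ Set.Ioc (0 : ℝ) 1 := iterate_quasiStep_mem hq0 hx
  have hle : ∀ n, baseSum q (quasiSeq q (R n)) ≤ alphaOne q / (q - 1) := fun n =>
    baseSum_le hq (quasiSeq_le_alphaOne hq0 (hmem n))
  have hnn : ∀ n, 0 ≤ baseSum q (quasiSeq q (R n)) := fun n => baseSum_nonneg hq _
  have h := nonpos_of_contracting hq (u := fun n => |baseSum q (quasiSeq q (R n)) - R n|)
    (C := alphaOne q / (q - 1) + 1) (fun k => ?_) (fun k => Or.inr ⟨k + 1, ?_⟩) 0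
  · exact sub_eq_zero.mp (abs_nonpos_iff.mp h)
  · rw [abs_le]
    constructor <;> linarith [hle k, hnn k, (hmem k).1, (hmem k).2]
  · have hsum := mul_baseSum hq (quasiSeq_le_alphaOne hq0 (hmem k))
    have hsucc : R (k + 1) = quasiStep q (R k) := Function.iterate_succ_apply' _ _ _
    rw [quasiSeq_succ, ← hsucc] at hsum
    have e : baseSum q (quasiSeq q (R (k + 1))) - R (k + 1) =
        q * (baseSum q (quasiSeq q (R k)) - R k) := by
      rw [mul_sub, hsum, hsucc, quasiStep]
      simp only [quasiSeq, Function.iterate_zero, id]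
      ring
    simp only [e, abs_mul, abs_of_pos hq0]
    rw [mul_div_cancel_left₀ _ hq0.ne']

theorem infiniteSeq_quasiSeq {q x : ℝ} (hq : 1 < q) (hx : x ∈ Set.Ioc (0 : ℝ) 1) :
    InfiniteSeq (quasiSeq q x) := by
  have hq0 : 0 < q := zero_lt_one.trans hq
  refine Set.infinite_of_not_bddAbove ?_
  rintro ⟨N, hN⟩
  have hzero : (fun i => quasiSeq q x (N + 1 + i)) = fun _ => 0 := by
    ext i
    by_contra h
    have := hN h
    omega
  have h := baseSum_quasiSeq hq (iterate_quasiStep_mem hq0 hx (N + 1))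
  rw [← quasiSeq_shift, hzero] at h
  have hpos := (iterate_quasiStep_mem hq0 hx (N + 1)).1
  rw [← h] at hpos
  simp [baseSum] at hpos

theorem isQuasiGreedyOf_quasiSeq {q x : ℝ} (hq : 1 < q) (hx : x ∈ Set.Ioc (0 : ℝ) 1) :
    IsQuasiGreedyOf q x (quasiSeq q x) := by
  have hq0 : 0 < q := zero_lt_one.trans hq
  have hle := quasiSeq_le_alphaOne hq0 hx
  refine ⟨⟨hle, (baseSum_quasiSeq hq hx).symm⟩, infiniteSeq_quasiSeq hq hx, ?_⟩
  rintro c ⟨hc, hsum⟩ hinf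
  refine lexLe_of_not_lexLt ?_
  rintro ⟨n, hn, hlt⟩
  set y := (quasiStep q)^[n] x with hy
  have hymem : y ∈ Set.Ioc (0 : ℝ) 1 := iterate_quasiStep_mem hq0 hx n
  have hxc : baseSum q c = x := hsum.symm
  have htail : y = baseSum q fun i => c (n + i) := by
    have h := baseSum_sub_baseSum hq n hle hc hn
    rw [quasiSeq_shift, baseSum_quasiSeq hq hymem, baseSum_quasiSeq hq hx, hxc] at h
    linarith
  have hstep := mul_baseSum hq (c := fun i => c (n + i)) (M := alphaOne q) fun i => hc _
  obtain ⟨i, hi, hci⟩ := hinf.exists_ge (n + 1)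
  have hpos : 0 < baseSum q fun i => c (n + (i + 1)) :=
    baseSum_pos hq (fun i => hc _) (i := i - (n + 1)) (by
      convert hci using 2
      omega)
  have hdig := mul_le_quasiDigit_add_one hq0 hymem.1
  have hlt' : (quasiDigit q y : ℝ) + 1 ≤ c n := by exact_mod_cast hlt
  rw [← htail] at hstep
  simp only [add_zero] at hstep
  linarith

theorem IsQuasiGreedyOf.unique {q x : ℝ} {a b : ℕ → ℕ} (ha : IsQuasiGreedyOf q x a)
    (hb : IsQuasiGreedyOf q x b) : a = b :=
  (hb.2.2 a ha.1 ha.2.1).antisymm (ha.2.2 b hb.1 hb.2.1)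

theorem quasiGreedy_eq_quasiSeq {q x : ℝ} (hq : 1 < q) (hx : x ∈ Set.Ioc (0 : ℝ) 1) :
    quasiGreedy q x = quasiSeq q x := by
  have h : ∃ a, IsQuasiGreedyOf q x a := ⟨_, isQuasiGreedyOf_quasiSeq hq hx⟩
  rw [quasiGreedy, dif_pos h]
  exact h.choose_spec.unique (isQuasiGreedyOf_quasiSeq hq hx)

/-- The quasi-greedy algorithm is monotone in both the base and the starting point. -/
theorem not_quasiSeq_lexLt {q r x y : ℝ} (hq : 0 < q) (hqr : q ≤ r)
    (hx : x ∈ Set.Ioc (0 : ℝ) 1) (hxy : x ≤ y) : ¬ LexLt (quasiSeq r y) (quasiSeq q x) := by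
  rintro ⟨n, hn, hlt⟩
  have hmul : ∀ k, (quasiStep q)^[k] x ≤ (quasiStep r)^[k] y →
      q * (quasiStep q)^[k] x ≤ r * (quasiStep r)^[k] y := fun k hk =>
    mul_le_mul hqr hk (iterate_quasiStep_mem hq hx k).1.le (hq.le.trans hqr)
  have hR : ∀ k ≤ n, (quasiStep q)^[k] x ≤ (quasiStep r)^[k] y := by
    intro k
    induction k with
    | zero => exact fun _ => hxy
    | succ k ih =>
      intro hk
      have h := hmul k (ih (by omega))
      have hd : quasiDigit r _ = quasiDigit q _ := hn k (by omega)
      rw [Function.iterate_succ_apply', Function.iterate_succ_apply', quasiStep, quasiStep, hd]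
      linarith
  exact hlt.not_ge (Nat.sub_le_sub_right (Nat.ceil_mono (hmul n (hR n le_rfl))) 1)

theorem quasiSeq_one_ne {q r : ℝ} (hq : 1 < q) (hqr : q < r) : quasiSeq q 1 ≠ quasiSeq r 1 := by
  intro h
  have hq0 : 0 < q := zero_lt_one.trans hq
  have hr0 : 0 < r := hq0.trans hqr
  have hone : (1 : ℝ) ∈ Set.Ioc (0 : ℝ) 1 := ⟨one_pos, le_rfl⟩
  have hqm := iterate_quasiStep_mem hq0 hone
  have hrm := iterate_quasiStep_mem hr0 hone
  have hstep : ∀ k, (quasiStep r)^[k + 1] 1 - (quasiStep q)^[k + 1] 1 =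
      r * (quasiStep r)^[k] 1 - q * (quasiStep q)^[k] 1 := by
    intro k
    have hd : quasiDigit q _ = quasiDigit r _ := congrFun h k
    rw [Function.iterate_succ_apply', Function.iterate_succ_apply', quasiStep, quasiStep, hd]
    ring
  have hu := nonpos_of_contracting hq (C := 1)
    (u := fun k => (quasiStep r)^[k] 1 - (quasiStep q)^[k] 1)
    (fun k => by linarith [(hqm k).1, (hrm k).2])
    (fun k => Or.inr ⟨k + 1, by
      rw [le_div_iff₀ hq0, hstep]
      nlinarith [(hrm k).1]⟩) 1
  have h1 := hstep 0
  simp only [zero_add, Function.iterate_zero, id, mul_one] at h1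
  linarith

theorem quasiSeq_eq_of_tails_le_one {q : ℝ} (hq : 1 < q) {a : ℕ → ℕ} {M : ℕ}
    (haM : ∀ i, a i ≤ M) (ha : InfiniteSeq a) (htail : ∀ k, baseSum q (fun i => a (k + i)) ≤ 1) :
    quasiSeq q (baseSum q a) = a := by
  have hmem : ∀ k, baseSum q (fun i => a (k + i)) ∈ Set.Ioc (0 : ℝ) 1 := by
    intro k
    obtain ⟨i, hi, hai⟩ := ha.exists_ge k
    refine ⟨baseSum_pos hq (fun i => haM _) (i := i - k) ?_, htail k⟩
    convert hai using 2
    omega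
  have hmul : ∀ k, q * baseSum q (fun i => a (k + i)) - a k =
      baseSum q fun i => a (k + 1 + i) := by
    intro k
    rw [mul_baseSum hq (M := M) fun i => haM _]
    simp [add_assoc, add_comm 1]
  have hdigit : ∀ k, quasiDigit q (baseSum q fun i => a (k + i)) = a k := fun k =>
    quasiDigit_eq (hmul k ▸ hmem (k + 1))
  have hR : ∀ k, (quasiStep q)^[k] (baseSum q a) = baseSum q fun i => a (k + i) := by
    intro k
    induction k with
    | zero => simp
    | succ k ih => rw [Function.iterate_succ_apply', ih, quasiStep, hdigit, hmul]
  ext k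
  rw [quasiSeq, hR, hdigit]

theorem tails_le_one_of_shifts_lexLe {q : ℝ} (hq : 1 < q) {a : ℕ → ℕ} {M : ℕ}
    (haM : ∀ i, a i ≤ M) (hsum : baseSum q a = 1)
    (hshift : ∀ k, LexLe (fun i => a (k + 1 + i)) a) (k : ℕ) :
    baseSum q (fun i => a (k + i)) ≤ 1 := by
  have hq0 : 0 < q := zero_lt_one.trans hq
  suffices h : baseSum q (fun i => a (k + i)) - 1 ≤ 0 by linarith
  refine nonpos_of_contracting hq (u := fun k => baseSum q (fun i => a (k + i)) - 1)
    (C := M / (q - 1)) (fun k => ?_) (fun k => ?_) k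
  · have := baseSum_le hq (c := fun i => a (k + i)) (M := M) fun i => haM _
    linarith
  rcases k with _ | k
  · left
    simp [hsum]
  rcases hshift k with ⟨n, hn, hlt⟩ | h
  swap
  · left
    simp [h, hsum]
  have hdiff := baseSum_sub_baseSum hq n (fun i => haM (k + 1 + i)) haM hn
  have hc := mul_baseSum hq (c := fun i => a (k + 1 + (n + i))) (M := M) fun i => haM _
  have hd := mul_baseSum hq (c := fun i => a (n + i)) (M := M) fun i => haM _
  have hnn := baseSum_nonneg hq fun i => a (n + (i + 1))
  have hlt' : (a (k + 1 + n) : ℝ) + 1 ≤ a n := by exact_mod_cast hlt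
  have hidx : (fun i => a (k + 1 + (n + (i + 1)))) = fun i => a (k + 1 + n + 1 + i) := by
    ext i
    congr 1
    omega
  rw [hidx] at hc
  rw [hsum] at hdiff
  simp only [add_zero] at hc hd
  have hkey : q ^ n * q * (baseSum q (fun i => a (k + 1 + i)) - 1) ≤
      baseSum q (fun i => a (k + 1 + n + 1 + i)) - 1 := by
    rw [mul_comm (q ^ n), mul_assoc, hdiff, mul_sub, hc, hd]
    linarith
  by_cases h0 : baseSum q (fun i => a (k + 1 + i)) - 1 ≤ 0
  · exact Or.inl h0
  refine Or.inr ⟨k + 1 + n + 1, ?_⟩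
  rw [le_div_iff₀ hq0]
  refine le_trans ?_ hkey
  rw [mul_assoc, mul_comm _ q]
  exact le_mul_of_one_le_left (mul_nonneg hq0.le (not_le.mp h0).le) (one_le_pow₀ hq.le)

theorem continuousOn_baseSum {p : ℝ} (hp : 1 < p) {c : ℕ → ℕ} {M : ℕ} (hc : ∀ i, c i ≤ M) :
    ContinuousOn (fun q => baseSum q c) (Set.Ici p) := by
  have hp0 : 0 < p := zero_lt_one.trans hp
  refine continuousOn_tsum (u := fun i => (c i : ℝ) / p ^ (i + 1)) (fun i => ?_)
    (summable_digits hp hc) (fun i q hq => ?_)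
  · exact continuousOn_const.div (continuousOn_pow _) fun q hq => (pow_pos (hp0.trans_le hq) _).ne'
  · have hpq : p ≤ q := hq
    have hq0 : 0 < q := hp0.trans_le hq
    rw [Real.norm_of_nonneg (by positivity)]
    gcongr

theorem exists_one_le_baseSum {c : ℕ → ℕ} {M : ℕ} (hcM : ∀ i, c i ≤ M) (hc : InfiniteSeq c) :
    ∃ p : ℝ, 1 < p ∧ p ≤ 2 ∧ 1 ≤ baseSum p c := by
  obtain ⟨i, -, hi⟩ := hc.exists_ge 0
  obtain ⟨j, hij, hj⟩ := hc.exists_ge (i + 1)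
  set p : ℝ := 2 ^ (((j + 1 : ℕ) : ℝ)⁻¹) with hp
  have hp1 : 1 < p := Real.one_lt_rpow one_lt_two (by positivity)
  have hp0 : 0 < p := zero_lt_one.trans hp1
  have hpow : p ^ (j + 1) = 2 := Real.rpow_inv_natCast_pow zero_le_two (Nat.succ_ne_zero j)
  refine ⟨p, hp1, hpow ▸ le_self_pow₀ hp1.le (Nat.succ_ne_zero j), ?_⟩
  have hterm : ∀ k, c k ≠ 0 → k ≤ j → 1 / 2 ≤ (c k : ℝ) / p ^ (k + 1) := by
    intro k hk hkj
    have h1 : (1 : ℝ) ≤ c k := by exact_mod_cast Nat.one_le_iff_ne_zero.mpr hk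
    have h2 : p ^ (k + 1) ≤ 2 := hpow ▸ pow_le_pow_right₀ hp1.le (by omega)
    gcongr
  have hle := (summable_digits hp1 hcM).sum_le_tsum {i, j} fun k _ => by positivity
  rw [Finset.sum_pair (by omega)] at hle
  have h1 := hterm i hi (by omega)
  have h2 := hterm j hj le_rfl
  exact le_trans (by linarith) hle

theorem exists_baseSum_eq_one {c : ℕ → ℕ} {M : ℕ} (hcM : ∀ i, c i ≤ M) (hc : InfiniteSeq c) :
    ∃ q : ℝ, 1 < q ∧ baseSum q c = 1 := by
  obtain ⟨p, hp1, hp2, hp⟩ := exists_one_le_baseSum hcM hc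
  obtain ⟨i, -, hi⟩ := hc.exists_ge 0
  have hM : (1 : ℝ) ≤ M := by exact_mod_cast (Nat.one_le_iff_ne_zero.mpr hi).trans (hcM i)
  have hM1 : (1 : ℝ) < M + 1 := by linarith
  have hle : baseSum (M + 1) c ≤ 1 := by
    have h := baseSum_le hM1 hcM
    rwa [add_sub_cancel_right, div_self (by positivity)] at h
  obtain ⟨q, hq, hq1⟩ := intermediate_value_Icc' (by linarith : p ≤ M + 1)
    ((continuousOn_baseSum hp1 hcM).mono Set.Icc_subset_Ici_self) ⟨hle, hp⟩
  exact ⟨q, hp1.trans_le hq.1, hq1⟩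

/-- The map `q ↦ (α_i(q))` is a strictly increasing bijection from
`(1, ∞)` onto the set of infinite sequences all of whose shifts are lexicographically
at most the sequence itself. -/
theorem quasiGreedy_one_strictMono_bijective :
    (∀ q r : ℝ, 1 < q → q < r → LexLt (quasiGreedy q 1) (quasiGreedy r 1)) ∧
    (∀ q : ℝ, 1 < q → InfiniteSeq (quasiGreedy q 1) ∧
      ∀ k : ℕ, LexLe (fun i => quasiGreedy q 1 (k + 1 + i)) (quasiGreedy q 1)) ∧
    (∀ a : ℕ → ℕ, InfiniteSeq a → (∀ k : ℕ, LexLe (fun i => a (k + 1 + i)) a) →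
      ∃ q : ℝ, 1 < q ∧ quasiGreedy q 1 = a) := by
  have hone : (1 : ℝ) ∈ Set.Ioc (0 : ℝ) 1 := ⟨one_pos, le_rfl⟩
  refine ⟨fun q r hq hqr => ?_, fun q hq => ?_, fun a ha hshift => ?_⟩
  · rw [quasiGreedy_eq_quasiSeq hq hone, quasiGreedy_eq_quasiSeq (hq.trans hqr) hone]
    rcases lexLt_trichotomy_s15 (quasiSeq q 1) (quasiSeq r 1) with h | h | h
    · exact h
    · exact absurd h (quasiSeq_one_ne hq hqr)
    · exact absurd h (not_quasiSeq_lexLt (zero_lt_one.trans hq) hqr.le hone le_rfl)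
  · have hq0 : 0 < q := zero_lt_one.trans hq
    rw [quasiGreedy_eq_quasiSeq hq hone]
    refine ⟨infiniteSeq_quasiSeq hq hone, fun k => ?_⟩
    have hmem := iterate_quasiStep_mem hq0 hone (k + 1)
    rw [quasiSeq_shift]
    exact lexLe_of_not_lexLt (not_quasiSeq_lexLt hq0 le_rfl hmem hmem.2)
  · have ha0 : ∀ i, a i ≤ a 0 := by
      rintro (_ | i)
      · exact le_rfl
      · exact (hshift i).apply_zero_le
    obtain ⟨q, hq, hsum⟩ := exists_baseSum_eq_one ha0 ha
    refine ⟨q, hq, ?_⟩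
    rw [quasiGreedy_eq_quasiSeq hq hone]
    have h := quasiSeq_eq_of_tails_le_one hq ha0 ha
      (tails_le_one_of_shifts_lexLe hq ha0 hsum hshift)
    rwa [hsum] at h
end
end
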